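/- There exists a universal constant K > 0 (independent of the convex set) such that for every bounded open convex subset C of ℝ², λ₁(C) ≥ K · I_∞(C)². -/

import Mathlib

open MeasureTheory Set Filter
open scoped ENNReal NNReal

noncomputable section

/-- Euclidean `n`-space. -/
abbrev Euc (n : ℕ) : Type := EuclideanSpace ℝ (Fin n)

/-- The set of parameters `t` such that `p + t • v` lies in `C`. For `C` open bounded
convex, `p ∈ C` and `v ≠ 0` this is an open interval `(t⁻, t⁺)` with `t⁻ < 0 < t⁺`;
the points `p + t⁻ • v` and `p + t⁺ • v` are the two intersections of the boundary `∂C`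
with the line through `p` directed by `v`. -/
def lineParams {n : ℕ} (C : Set (Euc n)) (p v : Euc n) : Set ℝ := {t : ℝ | p + t • v ∈ C}

open Classical in
/-- The Hilbert distance of the convex set `C`: with `a = p + t⁻ • (q - p)` and
`b = p + t⁺ • (q - p)` the two boundary points (so that `a, p, q, b` are in this order),
the cross-ratio `(‖q-a‖ ‖p-b‖)/(‖p-a‖ ‖q-b‖)` equals `((1 - t⁻) t⁺)/((-t⁻)(t⁺ - 1))`. -/
def hDist {n : ℕ} (C : Set (Euc n)) (p q : Euc n) : ℝ :=
  if p = q then 0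
  else
    (1 / 2) * Real.log
      (((1 - sInf (lineParams C p (q - p))) * sSup (lineParams C p (q - p))) /
        ((-sInf (lineParams C p (q - p))) * (sSup (lineParams C p (q - p)) - 1)))

open Classical in
/-- The Hilbert Finsler norm of `u` at `p`: with `p⁺ = p + t⁺ • u`, `p⁻ = p + t⁻ • u`
the two boundary points on the line through `p` directed by `u`, one has
`(1/2)‖u‖(1/‖p-p⁺‖ + 1/‖p-p⁻‖) = (1/2)(1/t⁺ - 1/t⁻)`. -/
def fNorm {n : ℕ} (C : Set (Euc n)) (p u : Euc n) : ℝ :=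
  if u = 0 then 0
  else (1 / 2) * (1 / sSup (lineParams C p u) - 1 / sInf (lineParams C p u))

/-- The dual norm of a linear form `l` at `p`: `sup {l u : ‖u‖_{C,p} = 1}`. -/
def dualNorm {n : ℕ} (C : Set (Euc n)) (p : Euc n) (l : Euc n →L[ℝ] ℝ) : ℝ :=
  sSup ((fun u => l u) '' {u : Euc n | fNorm C p u = 1})

/-- The tangent ball `TB_R(p) = {u : ‖u‖_{C,p} < R}`. -/
def tangentBall {n : ℕ} (C : Set (Euc n)) (p : Euc n) (R : ℝ) : Set (Euc n) :=
  {u : Euc n | fNorm C p u < R}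

/-- `ωₙ`, the Lebesgue volume of the Euclidean unit ball of `ℝⁿ`. -/
def omegaVol (n : ℕ) : ℝ := (volume (Metric.ball (0 : Euc n) 1)).toReal

/-- The Hilbert (Busemann) measure of `C`: density `ωₙ / vol_e(TB_C(p))` against
Lebesgue measure, supported on `C`. -/
def hMeasure {n : ℕ} (C : Set (Euc n)) : Measure (Euc n) :=
  (volume.restrict C).withDensity fun p =>
    ENNReal.ofReal (omegaVol n / (volume (tangentBall C p 1)).toReal)

/-- Admissible test functions: nonzero Lipschitz functions with compact support
contained in `Ω`. -/
def testFuns {n : ℕ} (Ω : Set (Euc n)) : Set (Euc n → ℝ) :=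
  {f : Euc n → ℝ |
    (∃ K : ℝ≥0, LipschitzWith K f) ∧ f ≠ 0 ∧ HasCompactSupport f ∧ tsupport f ⊆ Ω}

/-- The Rayleigh quotient of `f` on `Ω`, with respect to the Hilbert geometry of `C`
(`df` is the a.e.-defined differential of the Lipschitz function `f`). -/
def rayleigh {n : ℕ} (C Ω : Set (Euc n)) (f : Euc n → ℝ) : ℝ :=
  (∫ p in Ω, dualNorm C p (fderiv ℝ f p) ^ 2 ∂hMeasure C) /
    ∫ p in Ω, f p ^ 2 ∂hMeasure C

/-- The Dirichlet bottom of the spectrum `λ₁^C(Ω)`. -/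
def lambda1D {n : ℕ} (C Ω : Set (Euc n)) : ℝ := sInf (rayleigh C Ω '' testFuns Ω)

/-- The bottom of the spectrum `λ₁(C)` of the Hilbert geometry of `C`. -/
def lambda1 {n : ℕ} (C : Set (Euc n)) : ℝ := lambda1D C C

/-- The Gromov product `(x|y)_t = (d(x,t) + d(y,t) - d(x,y))/2`. -/
def gromovProd {n : ℕ} (d : Euc n → Euc n → ℝ) (x y t : Euc n) : ℝ :=
  (d x t + d y t - d x y) / 2

/-- `(C, d_C)` is `δ`-hyperbolic: for all `x y z t` in `C`,
`(x|y)_t ≥ min((x|z)_t, (y|z)_t) - δ`. -/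
def IsDeltaHyp {n : ℕ} (C : Set (Euc n)) (δ : ℝ) : Prop :=
  ∀ x ∈ C, ∀ y ∈ C, ∀ z ∈ C, ∀ t ∈ C,
    gromovProd (hDist C) x y t ≥
      min (gromovProd (hDist C) x z t) (gromovProd (hDist C) y z t) - δ

/-- The metric ball `B_R(x)` of the Hilbert metric of `C`. -/
def hBall {n : ℕ} (C : Set (Euc n)) (x : Euc n) (R : ℝ) : Set (Euc n) :=
  {y ∈ C | hDist C x y < R}

/-- The image of `C` under the homothety of center `P₀` and ratio `r`. -/
def homoth {n : ℕ} (P₀ : Euc n) (r : ℝ) (C : Set (Euc n)) : Set (Euc n) :=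
  (fun x => P₀ + r • (x - P₀)) '' C

/-- Diameter of a set with respect to a distance function `d`. -/
def ediamD {α : Type*} (d : α → α → ℝ) (S : Set α) : ℝ≥0∞ :=
  ⨆ x ∈ S, ⨆ y ∈ S, ENNReal.ofReal (d x y)

/-- The `k`-dimensional Hausdorff measure of `S` with respect to the distance
function `d`. -/
def hausD {α : Type*} (k : ℝ) (d : α → α → ℝ) (S : Set α) : ℝ≥0∞ :=
  ⨆ (ε : ℝ≥0∞) (_ : 0 < ε),
    ⨅ (U : ℕ → Set α) (_ : S ⊆ ⋃ i, U i) (_ : ∀ i, ediamD d (U i) ≤ ε),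
      ∑' i, ediamD d (U i) ^ k

/-- The frontier of `U` is a rectifiable closed curve (for the Hilbert metric of `C`):
it is the image of a closed continuous curve and has finite one-dimensional Hausdorff
measure. -/
def RectCurveBoundary (C U : Set (Euc 2)) : Prop :=
  ∃ c : ℝ → Euc 2, ContinuousOn c (Icc 0 1) ∧ c '' Icc (0 : ℝ) 1 = frontier U ∧
    c 0 = c 1 ∧ hausD 1 (hDist C) (frontier U) < ⊤

/-- The Cheeger constant `I_∞^C(Ω)` in dimension `2`: infimum of
`ν_C(∂U)/μ_C(U)` over open sets `U` with closure contained in `Ω` whose boundary is a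
rectifiable curve, `ν_C` being the `1`-dimensional Hausdorff measure of `(C, d_C)`. -/
def cheeger2D (C Ω : Set (Euc 2)) : ℝ :=
  sInf {r : ℝ | ∃ U : Set (Euc 2), IsOpen U ∧ U.Nonempty ∧ closure U ⊆ Ω ∧
    RectCurveBoundary C U ∧
    r = (hausD 1 (hDist C) (frontier U)).toReal / (hMeasure C U).toReal}

/-- The Cheeger constant `I_∞(C)` of a planar Hilbert geometry. -/
def cheeger2 (C : Set (Euc 2)) : ℝ := cheeger2D C C

/-- `S` is a `C¹` hypersurface: near each of its points it is the zero set of a `C¹`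
function with nonvanishing differential. -/
def IsC1Hypersurface {n : ℕ} (S : Set (Euc n)) : Prop :=
  ∀ x ∈ S, ∃ (f : Euc n → ℝ) (U : Set (Euc n)), U ∈ nhds x ∧ ContDiffOn ℝ 1 f U ∧
    (∀ y ∈ U, fderiv ℝ f y ≠ 0) ∧ S ∩ U = {y ∈ U | f y = 0}

/-- The Cheeger constant `I_∞^C(Ω)` in dimension `n`: infimum of `ν_C(∂U)/μ_C(U)` over
open sets `U` with closure contained in `Ω` whose boundary is a `C¹` hypersurface,
`ν_C` being the `(n-1)`-dimensional Hausdorff measure of `(C, d_C)`. -/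
def cheegerND {n : ℕ} (C Ω : Set (Euc n)) : ℝ :=
  sInf {r : ℝ | ∃ U : Set (Euc n), IsOpen U ∧ U.Nonempty ∧ closure U ⊆ Ω ∧
    IsC1Hypersurface (frontier U) ∧
    r = (hausD ((n : ℝ) - 1) (hDist C) (frontier U)).toReal / (hMeasure C U).toReal}

/-- The boundary of the convex set `C` is of class `C¹`: through each boundary point
passes a unique supporting hyperplane. -/
def HasC1Boundary {n : ℕ} (C : Set (Euc n)) : Prop :=
  ∀ x ∈ frontier C, ∃! l : Euc n →L[ℝ] ℝ, ‖l‖ = 1 ∧ ∀ y ∈ C, l y ≤ l x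

/-- The convex set `C` is strictly convex: the open segment joining two distinct
boundary points is contained in `C`. -/
def IsStrictlyConvexSet {n : ℕ} (C : Set (Euc n)) : Prop :=
  ∀ x ∈ frontier C, ∀ y ∈ frontier C, x ≠ y → openSegment ℝ x y ⊆ C

end



open MeasureTheory Set Filter
open scoped ENNReal NNReal

namespace HC

structure Good (C : Set (Euc 2)) : Prop where
  conv : Convex ℝ C
  op : IsOpen C
  bdd : Bornology.IsBounded C

/-- translate of `C` putting `x` at the origin -/
def Dx (C : Set (Euc 2)) (x : Euc 2) : Set (Euc 2) := (fun y => x + y) ⁻¹' C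

noncomputable def G (C : Set (Euc 2)) (x u : Euc 2) : ℝ := gauge (Dx C x) u

section
variable {C : Set (Euc 2)} {x : Euc 2}

lemma Dx_zero (hx : x ∈ C) : (0 : Euc 2) ∈ Dx C x := by simpa [Dx] using hx
lemma Dx_open (hC : Good C) : IsOpen (Dx C x) := hC.op.preimage (by fun_prop)
lemma Dx_conv (hC : Good C) : Convex ℝ (Dx C x) := hC.conv.translate_preimage_right x
lemma Dx_nhds (hC : Good C) (hx : x ∈ C) : Dx C x ∈ nhds (0 : Euc 2) :=
  (Dx_open hC).mem_nhds (Dx_zero hx)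
lemma Dx_abs (hC : Good C) (hx : x ∈ C) : Absorbent ℝ (Dx C x) :=
  absorbent_nhds_zero (Dx_nhds hC hx)
lemma exists_R (hC : Good C) : ∃ R : ℝ, 0 < R ∧ ∀ x ∈ C, Dx C x ⊆ Metric.closedBall 0 R := by
  obtain ⟨R, hR⟩ := hC.bdd.subset_closedBall (0 : Euc 2)
  refine ⟨2 * |R| + 1, by positivity, ?_⟩
  intro x hx y hy
  have h1 := hR hx
  have h2 := hR (show x + y ∈ C from hy)
  simp only [Metric.mem_closedBall, dist_zero_right] at *
  have h3 : ‖y‖ ≤ ‖x + y‖ + ‖x‖ := by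
    have := norm_sub_le (x + y) x
    simpa using this
  have := le_abs_self R
  linarith

lemma G_nonneg (u : Euc 2) : 0 ≤ G C x u := gauge_nonneg u
lemma G_zero : G C x 0 = 0 := gauge_zero

lemma G_smul {a : ℝ} (ha : 0 ≤ a) (u : Euc 2) : G C x (a • u) = a * G C x u := by
  unfold G; rw [gauge_smul_of_nonneg ha]; simp

lemma G_add (hC : Good C) (hx : x ∈ C) (u v : Euc 2) : G C x (u + v) ≤ G C x u + G C x v :=
  gauge_add_le (Dx_conv hC) (Dx_abs hC hx) u v

lemma G_lt_iff (hC : Good C) (hx : x ∈ C) {c : ℝ} (hc : 0 < c) (u : Euc 2) :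
    G C x u < c ↔ x + c⁻¹ • u ∈ C := by
  have h1 : G C x u < c ↔ gauge (Dx C x) (c⁻¹ • u) < 1 := by
    rw [gauge_smul_of_nonneg (by positivity : (0:ℝ) ≤ c⁻¹), smul_eq_mul, inv_mul_lt_one₀ hc]
    rfl
  rw [h1, gauge_lt_one_iff_mem_interior (Dx_conv hC) (Dx_nhds hC hx), (Dx_open hC).interior_eq]
  rfl

lemma G_le_of_ball (hC : Good C) {r : ℝ} (hr : 0 < r) (hb : Metric.ball x r ⊆ C) (u : Euc 2) :
    G C x u ≤ ‖u‖ / r := by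
  have : Metric.ball (0 : Euc 2) r ⊆ Dx C x := by
    intro y hy
    apply hb
    simpa using hy
  rw [le_div_iff₀ hr, mul_comm]
  exact mul_gauge_le_norm this

lemma le_G {R : ℝ} (hC : Good C) (hx : x ∈ C) (hR : 0 < R)
    (hb : Dx C x ⊆ Metric.closedBall 0 R) (u : Euc 2) : ‖u‖ / R ≤ G C x u :=
  le_gauge_of_subset_closedBall (Dx_abs hC hx) hR.le hb

lemma G_pos (hC : Good C) (hx : x ∈ C) {u : Euc 2} (hu : u ≠ 0) : 0 < G C x u := by
  obtain ⟨R, hR, h⟩ := exists_R hC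
  have := le_G hC hx hR (h x hx) u
  have h2 : 0 < ‖u‖ / R := by positivity
  linarith

lemma G_compare (hC : Good C) {r : ℝ} (hb : Metric.ball x r ⊆ C) {p : Euc 2}
    (hp : dist p x < r / 2) (u : Euc 2) : G C p u ≤ 2 * G C x u := by
  have hr : 0 < r := by have := dist_nonneg (x := p) (y := x); linarith
  have hx : x ∈ C := hb (Metric.mem_ball_self hr)
  have hpC : p ∈ C := hb (by rw [Metric.mem_ball]; linarith)
  refine le_of_forall_pos_lt_add fun ε hε => ?_
  set c := G C x u + ε / 2 with hc
  have hc0 : 0 < c := by have := G_nonneg (C := C) (x := x) u; positivity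
  have h1 : x + c⁻¹ • u ∈ C := (G_lt_iff hC hx hc0 u).1 (by linarith)
  have h2 : x + (2:ℝ) • (p - x) ∈ C := by
    apply hb
    rw [Metric.mem_ball, dist_eq_norm, add_sub_cancel_left, norm_smul, ← dist_eq_norm]
    norm_num; linarith
  have h3 := hC.conv h1 h2 (by norm_num : (0:ℝ) ≤ 1/2) (by norm_num : (0:ℝ) ≤ 1/2) (by norm_num)
  have h4 : G C p u < 2 * c := by
    rw [G_lt_iff hC hpC (by positivity)]
    convert h3 using 1
    rw [mul_inv]
    module
  linarith

/-- sup of the line parameters -/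
lemma sSup_line (hC : Good C) (hx : x ∈ C) {u : Euc 2} (hu : u ≠ 0) :
    sSup (lineParams C x u) = 1 / G C x u := by
  have hG := G_pos hC hx hu
  have key : ∀ t : ℝ, 0 < t → (t ∈ lineParams C x u ↔ t < 1 / G C x u) := by
    intro t ht
    have := G_lt_iff hC hx (c := t⁻¹) (by positivity) u
    rw [inv_inv] at this
    show x + t • u ∈ C ↔ _
    rw [← this, lt_div_iff₀ hG, ← one_div, lt_div_iff₀ ht, mul_comm]
  apply csSup_eq_of_forall_le_of_forall_lt_exists_gt
  · exact ⟨0, by simpa [lineParams] using hx⟩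
  · intro t ht
    rcases le_or_gt t 0 with h | h
    · exact h.trans (by positivity)
    · exact ((key t h).1 ht).le
  · intro w hw
    obtain ⟨t, h1, h2⟩ := exists_between (show max w 0 < 1 / G C x u from max_lt hw (by positivity))
    exact ⟨t, (key t ((le_max_right _ _).trans_lt h1)).2 h2, (le_max_left _ _).trans_lt h1⟩

lemma sInf_line (hC : Good C) (hx : x ∈ C) {u : Euc 2} (hu : u ≠ 0) :
    sInf (lineParams C x u) = - (1 / G C x (-u)) := by
  rw [← sSup_line hC hx (neg_ne_zero.2 hu), Real.sInf_def]
  congr 2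
  ext t
  simp [lineParams]

lemma fNorm_eq (hC : Good C) (hx : x ∈ C) (u : Euc 2) :
    fNorm C x u = (1 / 2) * (G C x u + G C x (-u)) := by
  unfold fNorm
  split_ifs with h
  · subst h; simp [G_zero]
  · rw [sSup_line hC hx h, sInf_line hC hx h]
    simp

lemma fNorm_zero : fNorm C x 0 = 0 := by simp [fNorm]

lemma fNorm_nonneg (hC : Good C) (hx : x ∈ C) (u : Euc 2) : 0 ≤ fNorm C x u := by
  rw [fNorm_eq hC hx]
  have := G_nonneg (C := C) (x := x) u
  have := G_nonneg (C := C) (x := x) (-u)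
  positivity

lemma fNorm_pos (hC : Good C) (hx : x ∈ C) {u : Euc 2} (hu : u ≠ 0) : 0 < fNorm C x u := by
  rw [fNorm_eq hC hx]
  have := G_pos hC hx hu
  have := G_nonneg (C := C) (x := x) (-u)
  positivity

lemma fNorm_smul (hC : Good C) (hx : x ∈ C) (a : ℝ) (u : Euc 2) :
    fNorm C x (a • u) = |a| * fNorm C x u := by
  rw [fNorm_eq hC hx, fNorm_eq hC hx]
  rcases le_total 0 a with h | h
  · rw [abs_of_nonneg h, ← smul_neg, G_smul h, G_smul h]; ring
  · rw [abs_of_nonpos h]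
    have e1 : a • u = (-a) • (-u) := by module
    have e2 : -(a • u) = (-a) • u := by module
    rw [e2, e1, G_smul (by linarith), G_smul (by linarith)]; ring

lemma fNorm_add (hC : Good C) (hx : x ∈ C) (u v : Euc 2) :
    fNorm C x (u + v) ≤ fNorm C x u + fNorm C x v := by
  rw [fNorm_eq hC hx, fNorm_eq hC hx, fNorm_eq hC hx]
  have h1 := G_add hC hx u v
  have h2 := G_add hC hx (-u) (-v)
  rw [neg_add]
  linarith

lemma fNorm_le (hC : Good C) {r : ℝ} (hr : 0 < r) (hb : Metric.ball x r ⊆ C) (u : Euc 2) :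
    fNorm C x u ≤ ‖u‖ / r := by
  rw [fNorm_eq hC (hb (Metric.mem_ball_self hr))]
  have h1 := G_le_of_ball hC hr hb u
  have h2 := G_le_of_ball hC hr hb (-u)
  rw [norm_neg] at h2
  linarith

lemma le_fNorm {R : ℝ} (hC : Good C) (hx : x ∈ C) (hR : 0 < R)
    (hb : Dx C x ⊆ Metric.closedBall 0 R) (u : Euc 2) : ‖u‖ / R ≤ fNorm C x u := by
  rw [fNorm_eq hC hx]
  have h1 := le_G hC hx hR hb u
  have h2 := le_G hC hx hR hb (-u)
  rw [norm_neg] at h2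
  linarith

lemma fNorm_compare (hC : Good C) {r : ℝ} (hb : Metric.ball x r ⊆ C) {p : Euc 2}
    (hp : dist p x < r / 2) (u : Euc 2) : fNorm C p u ≤ 2 * fNorm C x u := by
  have hr : 0 < r := by have := dist_nonneg (x := p) (y := x); linarith
  have hx : x ∈ C := hb (Metric.mem_ball_self hr)
  have hpC : p ∈ C := hb (by rw [Metric.mem_ball]; linarith)
  rw [fNorm_eq hC hx, fNorm_eq hC hpC]
  have h1 := G_compare hC hb hp u
  have h2 := G_compare hC hb hp (-u)
  linarith

lemma hDist_le (hC : Good C) {p q : Euc 2} (hp : p ∈ C) (h : G C p (q - p) ≤ 1 / 2) :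
    hDist C p q ≤ 2 * fNorm C p (q - p) := by
  unfold hDist
  split_ifs with hpq
  · subst hpq; simp [fNorm_zero]
  · have hv : q - p ≠ 0 := sub_ne_zero.2 (Ne.symm hpq)
    rw [fNorm_eq hC hp, sSup_line hC hp hv, sInf_line hC hp hv]
    have ha := G_pos hC hp hv
    have hb := G_pos hC hp (neg_ne_zero.2 hv)
    set a := G C p (q - p)
    set b := G C p (-(q - p))
    have e : ((1 - -(1 / b)) * (1 / a)) / (- -(1 / b) * (1 / a - 1)) = (1 + b) * (1 / (1 - a)) := by
      have : 1 - a ≠ 0 := by linarith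
      have h2 : (1 / a - 1) = (1 - a) / a := by field_simp
      rw [h2]
      field_simp
      ring
    rw [e, Real.log_mul (by positivity) (one_div_ne_zero (by linarith))]
    have h1 : Real.log (1 + b) ≤ b := by
      have := Real.log_le_sub_one_of_pos (show 0 < 1 + b by positivity); linarith
    have h2 : Real.log (1 / (1 - a)) ≤ 2 * a := by
      have h3 : 0 < 1 - a := by linarith
      have := Real.log_le_sub_one_of_pos (show 0 < 1 / (1 - a) by positivity)
      have h4 : 1 / (1 - a) ≤ 1 + 2 * a := by
        rw [div_le_iff₀ h3]; nlinarith
      linarith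
    linarith

/-- local comparison of the Hilbert distance -/
lemma hDist_le_local (hC : Good C) {r : ℝ} (hr : 0 < r) (hb : Metric.ball x r ⊆ C) {p q : Euc 2}
    (hp : dist p x ≤ r / 8) (hq : dist q x ≤ r / 8) :
    hDist C p q ≤ 4 * fNorm C x (q - p) := by
  have hpC : p ∈ C := hb (by rw [Metric.mem_ball]; linarith)
  have h1 := G_compare hC hb (p := p) (by linarith) (q - p)
  have h2 := G_le_of_ball hC hr hb (q - p)
  have h3 : ‖q - p‖ ≤ r / 4 := by
    rw [← dist_eq_norm]
    have := dist_triangle q x p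
    rw [dist_comm x p] at this; linarith
  have h4 : ‖q - p‖ / r ≤ 1 / 4 := by rw [div_le_iff₀ hr]; linarith
  have h5 := hDist_le hC hpC (q := q) (by linarith)
  have h6 := fNorm_compare hC hb (p := p) (by linarith) (q - p)
  linarith

end
end HC

open MeasureTheory Set Filter
open scoped ENNReal NNReal

namespace HC

section
variable {α : Type*} {d : α → α → ℝ}

lemma hausD_le_of {S : Set α} {B : ℝ≥0∞}
    (h : ∀ ε : ℝ≥0∞, 0 < ε → ∃ U : ℕ → Set α, S ⊆ ⋃ i, U i ∧ (∀ i, ediamD d (U i) ≤ ε) ∧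
      ∑' i, ediamD d (U i) ^ (1:ℝ) ≤ B) : hausD 1 d S ≤ B := by
  unfold hausD
  refine iSup₂_le fun ε hε => ?_
  obtain ⟨U, h1, h2, h3⟩ := h ε hε
  refine iInf_le_of_le U ?_
  refine iInf_le_of_le h1 ?_
  exact iInf_le_of_le h2 h3

lemma hausD_exists {S : Set α} {ε B : ℝ≥0∞} (hε : 0 < ε) (hB : hausD 1 d S < B) :
    ∃ U : ℕ → Set α, S ⊆ ⋃ i, U i ∧ (∀ i, ediamD d (U i) ≤ ε) ∧
      ∑' i, ediamD d (U i) ^ (1:ℝ) < B := by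
  have h := lt_of_le_of_lt (le_iSup₂ (f := fun (ε : ℝ≥0∞) (_ : 0 < ε) =>
    ⨅ (U : ℕ → Set α) (_ : S ⊆ ⋃ i, U i) (_ : ∀ i, ediamD d (U i) ≤ ε),
      ∑' i, ediamD d (U i) ^ (1:ℝ)) ε hε) hB
  simp only [iInf_lt_iff] at h
  obtain ⟨U, h1, h2, h3⟩ := h
  exact ⟨U, h1, h2, h3⟩

lemma ediamD_empty : ediamD d (∅ : Set α) = 0 := by simp [ediamD]

lemma hausD_empty : hausD 1 d (∅ : Set α) = 0 := by
  refine le_antisymm (hausD_le_of fun ε _ => ⟨fun _ => ∅, by simp, by simp [ediamD_empty], ?_⟩)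
    zero_le
  simp [ediamD_empty]

lemma hausD_union (S T : Set α) : hausD 1 d (S ∪ T) ≤ hausD 1 d S + hausD 1 d T := by
  by_cases hfin : hausD 1 d S + hausD 1 d T = ⊤
  · rw [hfin]; exact le_top
  have hS : hausD 1 d S ≠ ⊤ := fun h => hfin (by simp [h])
  have hT : hausD 1 d T ≠ ⊤ := fun h => hfin (by simp [h])
  refine ENNReal.le_of_forall_pos_le_add fun η hη _ => ?_
  have hη' : (0 : ℝ≥0∞) < (η : ℝ≥0∞) / 2 := by
    apply ENNReal.div_pos <;> simp [hη.ne']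
  refine hausD_le_of fun ε hε => ?_
  obtain ⟨U, hU1, hU2, hU3⟩ := hausD_exists (d := d) (S := S) hε (ENNReal.lt_add_right hS hη'.ne')
  obtain ⟨V, hV1, hV2, hV3⟩ := hausD_exists (d := d) (S := T) hε (ENNReal.lt_add_right hT hη'.ne')
  let W : ℕ ⊕ ℕ → Set α := Sum.elim U V
  let e : ℕ ≃ ℕ ⊕ ℕ := Equiv.natSumNatEquivNat.symm
  refine ⟨fun i => W (e i), ?_, ?_, ?_⟩
  · rintro x (hx | hx)
    · obtain ⟨i, hi⟩ := mem_iUnion.1 (hU1 hx)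
      exact mem_iUnion.2 ⟨e.symm (Sum.inl i), by simpa [W] using hi⟩
    · obtain ⟨i, hi⟩ := mem_iUnion.1 (hV1 hx)
      exact mem_iUnion.2 ⟨e.symm (Sum.inr i), by simpa [W] using hi⟩
  · intro i
    rcases h : e i with j | j
    · simpa [h, W] using hU2 j
    · simpa [h, W] using hV2 j
  · rw [e.tsum_eq (fun i => ediamD d (W i) ^ (1:ℝ)), ENNReal.summable.tsum_sum ENNReal.summable]
    refine (add_le_add hU3.le hV3.le).trans (le_of_eq ?_)
    rw [add_add_add_comm, ENNReal.add_halves]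

lemma hausD_biUnion {ι : Type*} (s : Finset ι) (f : ι → Set α) :
    hausD 1 d (⋃ i ∈ s, f i) ≤ ∑ i ∈ s, hausD 1 d (f i) := by
  classical
  induction s using Finset.induction_on with
  | empty => simp [hausD_empty]
  | insert a s ha ih =>
    rw [Finset.sum_insert ha, Finset.set_biUnion_insert]
    exact (hausD_union _ _).trans (by gcongr)

lemma hausD_curve {S : Set α} {γ : ℝ → α} {B : ℝ} (hB : 0 ≤ B) (hS : S ⊆ γ '' Icc 0 1)
    (h : ∀ s ∈ Icc (0:ℝ) 1, ∀ t ∈ Icc (0:ℝ) 1, d (γ s) (γ t) ≤ B * |t - s|) :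
    hausD 1 d S ≤ ENNReal.ofReal B := by
  refine hausD_le_of fun ε hε => ?_
  obtain ⟨n, hn0, hn⟩ : ∃ n : ℕ, 0 < n ∧ ENNReal.ofReal (B / n) ≤ ε := by
    have h1 : Tendsto (fun n : ℕ => ENNReal.ofReal (B / n)) atTop (nhds 0) := by
      have := ENNReal.tendsto_ofReal (tendsto_const_div_atTop_nhds_zero_nat B)
      simpa using this
    have h2 := h1.eventually (ge_mem_nhds hε)
    obtain ⟨n, h3, h4⟩ := (h2.and (eventually_gt_atTop 0)).exists
    exact ⟨n, h4, h3⟩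
  have hn' : (0:ℝ) < n := by exact_mod_cast hn0
  let U : ℕ → Set α := fun i => if i < n then γ '' Icc ((i:ℝ)/n) ((i+1:ℝ)/n) else ∅
  have hd : ∀ i, ediamD d (U i) ≤ ENNReal.ofReal (B / n) := by
    intro i
    by_cases hi : i < n
    · simp only [U, if_pos hi]
      refine iSup₂_le ?_
      rintro _ ⟨s, hs, rfl⟩
      refine iSup₂_le ?_
      rintro _ ⟨t, ht, rfl⟩
      apply ENNReal.ofReal_le_ofReal
      have hi' : (i:ℝ) + 1 ≤ n := by exact_mod_cast hi
      have b0 : (0:ℝ) ≤ (i:ℝ)/n := by positivity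
      have b1 : ((i:ℝ)+1)/n ≤ 1 := by rw [div_le_one hn']; exact hi'
      refine (h s ⟨b0.trans hs.1, hs.2.trans b1⟩ t ⟨b0.trans ht.1, ht.2.trans b1⟩).trans ?_
      rw [div_eq_mul_one_div]
      apply mul_le_mul_of_nonneg_left _ hB
      have e : ((i:ℝ)+1)/n = (i:ℝ)/n + 1/n := by ring
      rw [e] at hs ht
      rw [abs_le]; constructor <;> linarith [hs.1, hs.2, ht.1, ht.2]
    · simp only [U, if_neg hi, ediamD_empty]; exact zero_le
  refine ⟨U, ?_, fun i => (hd i).trans hn, ?_⟩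
  · intro x hx
    obtain ⟨s, hs, rfl⟩ := hS hx
    rcases eq_or_lt_of_le hs.2 with h1 | h1
    · refine mem_iUnion.2 ⟨n - 1, ?_⟩
      have : n - 1 < n := by omega
      simp only [U, if_pos this]
      refine ⟨s, ?_, rfl⟩
      have e : ((n - 1 : ℕ) : ℝ) = n - 1 := by
        rw [Nat.cast_sub (by omega)]; simp
      rw [e, h1]
      constructor
      · rw [div_le_one hn']; linarith
      · rw [le_div_iff₀ hn']; linarith
    · refine mem_iUnion.2 ⟨⌊s * n⌋₊, ?_⟩
      have h0 : 0 ≤ s * n := mul_nonneg hs.1 hn'.le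
      have h2 : ⌊s * n⌋₊ < n := by
        rw [Nat.floor_lt h0]; nlinarith
      simp only [U, if_pos h2]
      refine ⟨s, ⟨?_, ?_⟩, rfl⟩
      · rw [div_le_iff₀ hn']; exact Nat.floor_le h0
      · rw [le_div_iff₀ hn']; exact (Nat.lt_floor_add_one _).le
  · rw [tsum_eq_sum (s := Finset.range n)]
    · refine (Finset.sum_le_sum fun i _ => (by rw [ENNReal.rpow_one]; exact hd i :
        ediamD d (U i) ^ (1:ℝ) ≤ ENNReal.ofReal (B / n))).trans ?_
      rw [Finset.sum_const, Finset.card_range, nsmul_eq_mul, ← ENNReal.ofReal_natCast,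
        ← ENNReal.ofReal_mul hn'.le]
      apply ENNReal.ofReal_le_ofReal
      rw [mul_div_cancel₀ _ hn'.ne']
    · intro i hi
      have : ¬ i < n := by simpa using hi
      simp [U, this, ediamD_empty]

end

lemma hausD_segment {C : Set (Euc 2)} {x : Euc 2} (hC : Good C) {r : ℝ} (hr : 0 < r)
    (hb : Metric.ball x r ⊆ C) {a b : Euc 2}
    (ha : dist a x ≤ r / 8) (hb' : dist b x ≤ r / 8) :
    hausD 1 (hDist C) (segment ℝ a b) ≤ ENNReal.ofReal (4 * fNorm C x (b - a)) := by
  have hx : x ∈ C := hb (Metric.mem_ball_self hr)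
  have hF := fNorm_nonneg hC hx (b - a)
  apply hausD_curve (γ := fun t : ℝ => a + t • (b - a)) (by positivity)
  · rw [segment_eq_image']
  · intro s hs t ht
    have hseg : ∀ t ∈ Icc (0:ℝ) 1, dist (a + t • (b - a)) x ≤ r / 8 := by
      intro t ht
      have : a + t • (b - a) ∈ segment ℝ a b := by rw [segment_eq_image']; exact ⟨t, ht, rfl⟩
      exact (convex_closedBall x (r/8)).segment_subset ha hb' this
    refine (hDist_le_local hC hr hb (hseg s hs) (hseg t ht)).trans (le_of_eq ?_)
    have : a + t • (b - a) - (a + s • (b - a)) = (t - s) • (b - a) := by module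
    rw [this, fNorm_smul hC hx]; ring

end HC

open MeasureTheory Set Filter
open scoped ENNReal NNReal

namespace HC

/-- rotated vector -/
noncomputable def rot (a b : ℝ) : Euc 2 := !₂[-b, a]
noncomputable def e0 : Euc 2 := EuclideanSpace.single 0 1
noncomputable def e1 : Euc 2 := EuclideanSpace.single 1 1

lemma decomp (x : Euc 2) : x = x 0 • e0 + x 1 • e1 := by
  ext i; fin_cases i <;> simp [e0, e1]

lemma l_apply (l : Euc 2 →L[ℝ] ℝ) (x : Euc 2) : l x = x 0 * l e0 + x 1 * l e1 := by
  conv_lhs => rw [decomp x]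
  simp

lemma volume_box (a b : ℝ) :
    volume {x : Euc 2 | |x 0| ≤ a ∧ |x 1| ≤ b} = ENNReal.ofReal (2 * a) * ENNReal.ofReal (2 * b) := by
  have h : {x : Euc 2 | |x 0| ≤ a ∧ |x 1| ≤ b} =
      (WithLp.ofLp : Euc 2 → (Fin 2 → ℝ)) ⁻¹' Icc ![-a, -b] ![a, b] := by
    ext x
    simp [Pi.le_def, abs_le]
    tauto
  rw [h, (PiLp.volume_preserving_ofLp (Fin 2)).measure_preimage measurableSet_Icc.nullMeasurableSet,
    Real.volume_Icc_pi]
  simp [two_mul]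

section
variable {C : Set (Euc 2)} {x : Euc 2}

lemma fNorm_continuous (hC : Good C) (hx : x ∈ C) : Continuous (fNorm C x) := by
  have h : fNorm C x = fun u => (1 / 2) * (G C x u + G C x (-u)) := funext (fNorm_eq hC hx)
  have hG : Continuous (G C x) := continuous_gauge (Dx_conv hC) (Dx_nhds hC hx)
  rw [h]
  fun_prop

lemma unit_ne (hC : Good C) (hx : x ∈ C) {u : Euc 2} (hu : u ≠ 0) :
    fNorm C x ((fNorm C x u)⁻¹ • u) = 1 := by
  have := fNorm_pos hC hx hu
  rw [fNorm_smul hC hx, abs_of_nonneg (by positivity), inv_mul_cancel₀ this.ne']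

lemma norm_le_of_unit (hC : Good C) : ∃ R : ℝ, 0 < R ∧ ∀ x ∈ C, ∀ u : Euc 2,
    ‖u‖ ≤ R * fNorm C x u := by
  obtain ⟨R, hR, h⟩ := exists_R hC
  refine ⟨R, hR, fun x hx u => ?_⟩
  have := le_fNorm hC hx hR (h x hx) u
  rw [div_le_iff₀ hR] at this
  linarith

lemma dual_bdd (hC : Good C) (hx : x ∈ C) (l : Euc 2 →L[ℝ] ℝ) :
    BddAbove ((fun u => l u) '' {u : Euc 2 | fNorm C x u = 1}) := by
  obtain ⟨R, hR, h⟩ := norm_le_of_unit hC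
  refine ⟨‖l‖ * R, ?_⟩
  rintro _ ⟨u, hu, rfl⟩
  have h1 := h x hx u
  rw [show fNorm C x u = 1 from hu] at h1
  have := l.le_opNorm u
  have h3 := le_abs_self (l u)
  rw [Real.norm_eq_abs] at this
  have : ‖l‖ * ‖u‖ ≤ ‖l‖ * R := by gcongr; linarith
  simp only; linarith

lemma le_dual (hC : Good C) (hx : x ∈ C) (l : Euc 2 →L[ℝ] ℝ) (u : Euc 2) :
    l u ≤ dualNorm C x l * fNorm C x u := by
  by_cases hu : u = 0
  · subst hu; simp [fNorm_zero]
  have hp := fNorm_pos hC hx hu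
  have h := le_csSup (dual_bdd hC hx l) ⟨_, unit_ne hC hx hu, rfl⟩
  simp only [map_smul, smul_eq_mul] at h
  rw [inv_mul_le_iff₀ hp] at h
  unfold dualNorm; linarith

lemma e0_ne : e0 ≠ 0 := by
  intro h
  have := congrArg (fun v : Euc 2 => v 0) h
  simp [e0] at this

lemma dual_nonneg (hC : Good C) (hx : x ∈ C) (l : Euc 2 →L[ℝ] ℝ) : 0 ≤ dualNorm C x l := by
  have h1 := le_dual hC hx l e0
  have h2 := le_dual hC hx l (-e0)
  have h3 : fNorm C x (-e0) = fNorm C x e0 := by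
    have := fNorm_smul hC hx (-1) e0
    simpa using this
  rw [h3, map_neg] at h2
  have hp := fNorm_pos hC hx e0_ne
  by_contra hneg
  push Not at hneg
  nlinarith

lemma dual_ne (hC : Good C) (hx : x ∈ C) (l : Euc 2 →L[ℝ] ℝ) :
    ((fun u => l u) '' {u : Euc 2 | fNorm C x u = 1}).Nonempty :=
  ⟨_, _, unit_ne hC hx e0_ne, rfl⟩

lemma dual_le (hC : Good C) : ∃ R : ℝ, 0 < R ∧ ∀ x ∈ C, ∀ l : Euc 2 →L[ℝ] ℝ,
    dualNorm C x l ≤ R * ‖l‖ := by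
  obtain ⟨R, hR, h⟩ := norm_le_of_unit hC
  refine ⟨R, hR, fun x hx l => ?_⟩
  apply csSup_le (dual_ne hC hx l)
  rintro _ ⟨u, hu, rfl⟩
  have h1 := h x hx u
  rw [show fNorm C x u = 1 from hu] at h1
  have := l.le_opNorm u
  have h3 := le_abs_self (l u)
  rw [Real.norm_eq_abs] at this
  have : ‖l‖ * ‖u‖ ≤ ‖l‖ * R := by gcongr; linarith
  simp only; linarith

lemma lt_dual_iff (hC : Good C) (hx : x ∈ C) (l : Euc 2 →L[ℝ] ℝ) {c : ℝ} (hc : 0 ≤ c) :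
    c < dualNorm C x l ↔ ∃ u, c * fNorm C x u < l u := by
  constructor
  · intro h
    obtain ⟨_, ⟨u, hu, rfl⟩, h2⟩ :=
      exists_lt_of_lt_csSup (dual_ne hC hx l) h
    exact ⟨u, by rw [show fNorm C x u = 1 from hu]; simpa using h2⟩
  · rintro ⟨u, hu⟩
    have h1 := le_dual hC hx l u
    have h2 := fNorm_nonneg hC hx u
    by_contra hcon
    push Not at hcon
    have := mul_le_mul_of_nonneg_right hcon h2
    linarith

lemma tb_fin (hC : Good C) (hx : x ∈ C) : volume (tangentBall C x 1) ≠ ⊤ := by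
  obtain ⟨R, hR, h⟩ := norm_le_of_unit hC
  have : tangentBall C x 1 ⊆ Metric.closedBall 0 R := by
    intro u hu
    have h1 := h x hx u
    have h2 : fNorm C x u < 1 := hu
    simp only [Metric.mem_closedBall, dist_zero_right]
    nlinarith
  exact ((measure_mono this).trans_lt measure_closedBall_lt_top).ne

lemma tb_ball (hC : Good C) {r : ℝ} (hr : 0 < r) (hb : Metric.ball x r ⊆ C) :
    Metric.ball 0 r ⊆ tangentBall C x 1 := by
  intro u hu
  have h1 := fNorm_le hC hr hb u
  simp only [Metric.mem_ball, dist_zero_right] at hu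
  have : ‖u‖ / r < 1 := by rw [div_lt_one hr]; exact hu
  exact h1.trans_lt this

lemma tb_pos (hC : Good C) (hx : x ∈ C) : 0 < (volume (tangentBall C x 1)).toReal := by
  obtain ⟨r, hr, hb⟩ := Metric.isOpen_iff.1 hC.op x hx
  have h := (Metric.measure_ball_pos volume (0 : Euc 2) hr).trans_le
    (measure_mono (tb_ball hC hr hb))
  exact ENNReal.toReal_pos h.ne' (tb_fin hC hx)

lemma area_ineq (hC : Good C) (hx : x ∈ C) (l : Euc 2 →L[ℝ] ℝ) :
    fNorm C x (rot (l e0) (l e1)) * (volume (tangentBall C x 1)).toReal ≤ 24 * dualNorm C x l := by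
  by_cases hl : l = 0
  · subst hl
    have : rot ((0 : Euc 2 →L[ℝ] ℝ) e0) ((0 : Euc 2 →L[ℝ] ℝ) e1) = 0 := by
      ext i; fin_cases i <;> simp [rot]
    rw [this, fNorm_zero]
    have := dual_nonneg hC hx 0
    linarith
  set M := dualNorm C x l with hM
  set a := l e0 with ha
  set b := l e1 with hb
  set u := rot a b with hu
  have hab : 0 < a ^ 2 + b ^ 2 := by
    rcases eq_or_ne a 0 with h1 | h1
    · rcases eq_or_ne b 0 with h2 | h2
      · exfalso; apply hl; ext y; rw [l_apply, ← ha, ← hb, h1, h2]; simp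
      · positivity
    · positivity
  have hu0 : u 0 = -b := by simp [hu, rot]
  have hu1 : u 1 = a := by simp [hu, rot]
  have hune : u ≠ 0 := by
    intro h
    rw [h] at hu0 hu1
    simp at hu0 hu1
    rw [hu0, ← hu1] at hab; simp at hab
  have hFu := fNorm_pos hC hx hune
  have hMpos : 0 < M := by
    rw [hM, lt_dual_iff hC hx l le_rfl]
    refine ⟨a • e0 + b • e1, ?_⟩
    simp [← ha, ← hb]; nlinarith
  obtain ⟨_, ⟨v, hv, rfl⟩, hv2⟩ : ∃ y ∈ ((fun u => l u) '' {u : Euc 2 | fNorm C x u = 1}), M / 2 < y :=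
      exists_lt_of_lt_csSup (dual_ne hC hx l) (by
        show M / 2 < M
        linarith)
  simp only at hv2
  have hv : fNorm C x v = 1 := hv
  have hvM : l v ≤ M := by have := le_dual hC hx l v; rw [hv] at this; linarith
  have hlv : 0 < l v := by linarith
  let L : Euc 2 →ₗ[ℝ] Euc 2 :=
    { toFun := fun y => y 0 • v + y 1 • u
      map_add' := by intro y z; simp only [PiLp.add_apply]; module
      map_smul' := by intro c y; simp only [PiLp.smul_apply, smul_eq_mul, RingHom.id_apply]; module }
  have hdet : LinearMap.det L = l v := by
    rw [← LinearMap.det_toMatrix (EuclideanSpace.basisFun (Fin 2) ℝ).toBasis, Matrix.det_fin_two]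
    simp [LinearMap.toMatrix_apply, L, hu0, hu1]
    rw [l_apply l v, ← ha, ← hb]; ring
  set F := fNorm C x u with hF
  have hsub : tangentBall C x 1 ⊆ L '' {y : Euc 2 | |y 0| ≤ 2 ∧ |y 1| ≤ 3 / F} := by
    intro y hy
    have hy : fNorm C x y < 1 := hy
    have hy0 := fNorm_nonneg hC hx y
    set s := l y / l v with hs
    set z := y - s • v with hz
    have hlz : l z = 0 := by simp [hz, hs]; field_simp; ring
    have hsabs : |s| ≤ 2 := by
      have h1 := le_dual hC hx l y
      have h2 := le_dual hC hx l (-y)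
      have h3 : fNorm C x (-y) = fNorm C x y := by
        have := fNorm_smul hC hx (-1) y
        simpa using this
      rw [h3, map_neg] at h2
      have h5 : M * fNorm C x y ≤ M := by nlinarith
      rw [hs, abs_div, abs_of_pos hlv, div_le_iff₀ hlv, abs_le]
      constructor <;> linarith
    set τ := (-(z 0) * b + z 1 * a) / (a ^ 2 + b ^ 2) with hτ
    have hzl : z 0 * a + z 1 * b = 0 := by rw [← hlz, l_apply l z]
    have hzu : z = τ • u := by
      ext i
      fin_cases i
      · show z 0 = τ * u 0
        rw [hu0, hτ]; field_simp; linear_combination a * hzl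
      · show z 1 = τ * u 1
        rw [hu1, hτ]; field_simp; linear_combination b * hzl
    have hFz : fNorm C x z ≤ 3 := by
      have e : z = y + (-s) • v := by rw [hz]; module
      rw [e]
      have := fNorm_add hC hx y ((-s) • v)
      rw [fNorm_smul hC hx, hv, abs_neg] at this
      linarith
    rw [hzu, fNorm_smul hC hx] at hFz
    refine ⟨!₂[s, τ], ⟨by simpa using hsabs, ?_⟩, ?_⟩
    · show |τ| ≤ 3 / F
      rw [le_div_iff₀ hFu]; exact hFz
    · show s • v + τ • u = y
      rw [← hzu, hz]; module
  have hvol := measure_mono (μ := volume) hsub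
  rw [Measure.addHaar_image_linearMap, volume_box, hdet, abs_of_pos hlv,
    ← ENNReal.ofReal_mul (by norm_num), ← ENNReal.ofReal_mul hlv.le] at hvol
  have h2 := ENNReal.toReal_mono (by simp) hvol
  rw [ENNReal.toReal_ofReal (by positivity)] at h2
  calc F * (volume (tangentBall C x 1)).toReal ≤ F * (l v * (2 * 2 * (2 * (3 / F)))) := by gcongr
    _ = 24 * l v := by field_simp; ring
    _ ≤ 24 * M := by linarith

end
end HC

open MeasureTheory Set Filter
open scoped ENNReal NNReal

namespace HC

open Classical in
noncomputable def FF (C : Set (Euc 2)) (x u : Euc 2) : ℝ := if x ∈ C then fNorm C x u else 0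

open Classical in
noncomputable def GG (C : Set (Euc 2)) (x u : Euc 2) : ℝ := if x ∈ C then G C x u else 0

open Classical in
/-- real density -/
noncomputable def rd (C : Set (Euc 2)) (x : Euc 2) : ℝ :=
  if x ∈ C then omegaVol 2 / (volume (tangentBall C x 1)).toReal else 0

open Classical in
noncomputable def DN (C : Set (Euc 2)) (x : Euc 2) (l : Euc 2 →L[ℝ] ℝ) : ℝ :=
  if x ∈ C then dualNorm C x l else 0

section
variable {C : Set (Euc 2)}

lemma measurable_GG (hC : Good C) : Measurable fun z : Euc 2 × Euc 2 => GG C z.1 z.2 := by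
  apply measurable_of_Iio
  intro c
  have hm : MeasurableSet {z : Euc 2 × Euc 2 | z.1 ∈ C} :=
    (hC.op.preimage continuous_fst).measurableSet
  rcases le_or_gt c 0 with hc | hc
  · convert MeasurableSet.empty
    ext z
    simp only [mem_preimage, mem_Iio, mem_empty_iff_false, iff_false, not_lt, GG]
    split_ifs
    · exact hc.trans (G_nonneg _)
    · exact hc
  · have : ((fun z : Euc 2 × Euc 2 => GG C z.1 z.2) ⁻¹' Iio c) =
        {z : Euc 2 × Euc 2 | z.1 ∈ C}ᶜ ∪ {z : Euc 2 × Euc 2 | z.1 + c⁻¹ • z.2 ∈ C} ∩ {z | z.1 ∈ C} := by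
      ext z
      simp only [mem_preimage, mem_Iio, GG, mem_union, mem_compl_iff, mem_setOf_eq, mem_inter_iff]
      split_ifs with h
      · simp [G_lt_iff hC h hc, h]
      · simp [h, hc]
    rw [this]
    refine hm.compl.union (MeasurableSet.inter ?_ hm)
    exact (hC.op.preimage (by fun_prop)).measurableSet

lemma measurable_FF (hC : Good C) : Measurable fun z : Euc 2 × Euc 2 => FF C z.1 z.2 := by
  have h : (fun z : Euc 2 × Euc 2 => FF C z.1 z.2) =
      fun z => (1 / 2) * (GG C z.1 z.2 + GG C z.1 (-z.2)) := by
    ext z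
    unfold FF GG
    split_ifs with h
    · exact fNorm_eq hC h _
    · simp
  rw [h]
  have h1 := measurable_GG hC
  have h2 : Measurable fun z : Euc 2 × Euc 2 => GG C z.1 (-z.2) :=
    h1.comp (show Measurable fun z : Euc 2 × Euc 2 => (z.1, -z.2) by fun_prop)
  exact (h1.add h2).const_mul _

lemma measurable_rd (hC : Good C) : Measurable (rd C) := by
  have hs : MeasurableSet {z : Euc 2 × Euc 2 | FF C z.1 z.2 < 1} :=
    measurableSet_lt (measurable_FF hC) measurable_const
  have h1 := measurable_measure_prodMk_left (ν := (volume : Measure (Euc 2))) hs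
  have : rd C = C.indicator fun x =>
      omegaVol 2 / (volume (Prod.mk x ⁻¹' {z : Euc 2 × Euc 2 | FF C z.1 z.2 < 1})).toReal := by
    ext x
    unfold rd indicator
    split_ifs with h
    · congr 3
      ext u
      simp [tangentBall, FF, h]
    · rfl
  rw [this]
  exact (measurable_const.div h1.ennreal_toReal).indicator hC.op.measurableSet

lemma hMeasure_eq (hC : Good C) :
    hMeasure C = volume.withDensity fun x => ENNReal.ofReal (rd C x) := by
  unfold hMeasure
  rw [← withDensity_indicator hC.op.measurableSet]
  congr 1
  ext x
  unfold rd indicator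
  split_ifs <;> simp

lemma omega_pos : 0 < omegaVol 2 :=
  ENNReal.toReal_pos (Metric.measure_ball_pos volume (0 : Euc 2) one_pos).ne' measure_ball_lt_top.ne

lemma rd_nonneg (x : Euc 2) : 0 ≤ rd C x := by
  unfold rd
  split_ifs
  · exact div_nonneg omega_pos.le ENNReal.toReal_nonneg
  · rfl

lemma rd_pos (hC : Good C) {x : Euc 2} (hx : x ∈ C) : 0 < rd C x := by
  unfold rd
  rw [if_pos hx]
  exact div_pos omega_pos (tb_pos hC hx)

lemma measurable_DN (hC : Good C) {l : Euc 2 → Euc 2 →L[ℝ] ℝ} (hl : Measurable l) :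
    Measurable fun x => DN C x (l x) := by
  apply measurable_of_Ioi
  intro c
  rcases lt_or_ge c 0 with hc | hc
  · convert MeasurableSet.univ
    ext x
    simp only [mem_preimage, mem_Ioi, mem_univ, iff_true, DN]
    split_ifs with h
    · exact hc.trans_le (dual_nonneg hC h _)
    · exact hc
  · obtain ⟨D, hDc, hDd⟩ := TopologicalSpace.exists_countable_dense (Euc 2)
    have : ((fun x => DN C x (l x)) ⁻¹' Ioi c) =
        C ∩ ⋃ u ∈ D, {x | c * FF C x u < l x u} := by
      ext x
      simp only [mem_preimage, mem_Ioi, DN, mem_inter_iff, mem_iUnion, mem_setOf_eq, exists_prop]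
      split_ifs with h
      · rw [lt_dual_iff hC h _ hc]
        simp only [FF, if_pos h, h, true_and]
        constructor
        · rintro ⟨u, hu⟩
          have ho : IsOpen {u | c * fNorm C x u < l x u} :=
            isOpen_lt ((fNorm_continuous hC h).const_mul c |>.congr fun _ => rfl) (l x).continuous
          obtain ⟨v, hv1, hv2⟩ := hDd.exists_mem_open ho ⟨u, hu⟩
          exact ⟨v, hv1, hv2⟩
        · rintro ⟨u, _, hu⟩
          exact ⟨u, hu⟩
      · simp [h, hc]
    rw [this]
    refine hC.op.measurableSet.inter (MeasurableSet.biUnion hDc fun u _ => ?_)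
    apply measurableSet_lt
    · exact ((measurable_FF hC).comp (show Measurable fun x : Euc 2 => (x, u) by fun_prop)).const_mul c
    · exact (ContinuousLinearMap.measurable_apply u).comp hl

/-- bound on the density -/
lemma rd_le (hC : Good C) {x : Euc 2} {r : ℝ} (hr : 0 < r) (hb : Metric.ball x r ⊆ C) :
    rd C x ≤ omegaVol 2 / (volume (Metric.ball (0 : Euc 2) r)).toReal := by
  have hx : x ∈ C := hb (Metric.mem_ball_self hr)
  unfold rd
  rw [if_pos hx]
  have h0 : 0 < (volume (Metric.ball (0 : Euc 2) r)).toReal :=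
    ENNReal.toReal_pos (Metric.measure_ball_pos volume (0 : Euc 2) hr).ne' measure_ball_lt_top.ne
  apply div_le_div_of_nonneg_left omega_pos.le h0
  exact ENNReal.toReal_mono (tb_fin hC hx) (measure_mono (tb_ball hC hr hb))

lemma exists_thick (hC : Good C) {K : Set (Euc 2)} (hK : IsCompact K) (hKC : K ⊆ C) :
    ∃ r : ℝ, 0 < r ∧ ∀ x ∈ K, Metric.ball x r ⊆ C := by
  obtain ⟨r, hr, h⟩ := hK.exists_thickening_subset_open hC.op hKC
  exact ⟨r, hr, fun x hx => (Metric.ball_subset_thickening hx r).trans h⟩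

lemma hMeasure_compact (hC : Good C) {K : Set (Euc 2)} (hK : IsCompact K) (hKC : K ⊆ C) :
    hMeasure C K < ⊤ := by
  obtain ⟨r, hr, h⟩ := exists_thick hC hK hKC
  rw [hMeasure_eq hC, withDensity_apply _ hK.measurableSet]
  refine (setLIntegral_mono (g := fun _ => ENNReal.ofReal
    (omegaVol 2 / (volume (Metric.ball (0 : Euc 2) r)).toReal)) measurable_const
    fun x hx => ENNReal.ofReal_le_ofReal (rd_le hC hr (h x hx))).trans_lt ?_
  rw [lintegral_const]
  exact ENNReal.mul_lt_top (by simp) (by simpa using hK.measure_lt_top)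

end
end HC

open MeasureTheory Set Filter
open scoped ENNReal NNReal

namespace HC

abbrev Tri := (ℤ × ℤ) × Bool

/-- vertices of a triangle -/
def vt (T : Tri) : Fin 3 → ℤ × ℤ :=
  match T.2 with
  | false => ![(T.1.1, T.1.2), (T.1.1 + 1, T.1.2), (T.1.1 + 1, T.1.2 + 1)]
  | true => ![(T.1.1, T.1.2), (T.1.1, T.1.2 + 1), (T.1.1 + 1, T.1.2 + 1)]

def BB (h : ℤ → ℤ → Bool) (M : ℤ) : ℕ → ℤ → Bool
  | 0, _ => false
  | n + 1, j => BB h M n j ^^ h (-M + n) j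

lemma split_exists (a : ℤ × ℤ → Bool) (ha : {v | a v = true}.Finite) (Q : Set Tri)
    (hQ : ∀ T T' : Tri, ∀ m n m' n' : Fin 3, vt T m = vt T' m' → vt T n = vt T' n' →
      a (vt T m) ≠ a (vt T n) → (T ∈ Q ↔ T' ∈ Q)) :
    ∃ b : ℤ × ℤ → Bool, {v | b v = true}.Finite ∧
      (∀ T ∈ Q, ∀ m n, (b (vt T m) ^^ b (vt T n)) = (a (vt T m) ^^ a (vt T n))) ∧
      (∀ T ∉ Q, ∀ m n, b (vt T m) = b (vt T n)) := by
  classical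
  obtain ⟨M, hM0, hM⟩ : ∃ M : ℤ, 0 < M ∧ ∀ i j : ℤ, a (i, j) = true → -M < i ∧ i < M ∧ -M < j ∧ j < M := by
    obtain ⟨B, hB⟩ := ((ha.image fun v => |v.1| + |v.2|).bddAbove)
    refine ⟨|B| + 1, by positivity, fun i j hij => ?_⟩
    have h1 : |i| + |j| ≤ B := hB ⟨(i, j), hij, rfl⟩
    have := le_abs_self B
    have := abs_nonneg i
    have := abs_nonneg j
    have h2 := abs_le.1 (show |i| ≤ |B| by omega)
    have h3 := abs_le.1 (show |j| ≤ |B| by omega)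
    omega
  have hMf : ∀ i j : ℤ, (i ≤ -M ∨ M ≤ i ∨ j ≤ -M ∨ M ≤ j) → a (i, j) = false := by
    intro i j h
    by_contra hc
    have := hM i j (by simpa using hc)
    omega
  let e : Tri → Fin 3 → Fin 3 → Bool := fun T m n =>
    if T ∈ Q then a (vt T m) ^^ a (vt T n) else false
  have he : ∀ T T' : Tri, ∀ m n m' n' : Fin 3, vt T m = vt T' m' → vt T n = vt T' n' →
      e T m n = e T' m' n' := by
    intro T T' m n m' n' h1 h2
    by_cases hne : a (vt T m) = a (vt T n)
    · have : a (vt T' m') = a (vt T' n') := by rw [← h1, ← h2, hne]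
      simp [e, hne, this]
    · have := hQ T T' m n m' n' h1 h2 hne
      simp only [e, this, h1, h2]
  have hadd : ∀ T m n p, (e T m n ^^ e T n p) = e T m p := by
    intro T m n p
    simp only [e]
    split_ifs
    · cases a (vt T m) <;> cases a (vt T n) <;> cases a (vt T p) <;> rfl
    · rfl
  let h : ℤ → ℤ → Bool := fun i j => e ((i, j), false) 0 1
  let v : ℤ → ℤ → Bool := fun i j => e ((i, j), true) 0 1
  have hsq : ∀ i j, (h i j ^^ v (i + 1) j) = (v i j ^^ h i (j + 1)) := by
    intro i j
    have e1 : v (i + 1) j = e ((i, j), false) 1 2 := he _ _ _ _ _ _ rfl rfl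
    have e2 : h i (j + 1) = e ((i, j), true) 1 2 := he _ _ _ _ _ _ rfl rfl
    rw [e1, e2, hadd, hadd]
    exact he _ _ _ _ _ _ rfl rfl
  have hh : ∀ i j, (i + 1 ≤ -M ∨ M ≤ i ∨ j ≤ -M ∨ M ≤ j) → h i j = false := by
    intro i j hij
    have h1 : a (vt ((i, j), false) 0) = false := hMf i j (by omega)
    have h2 : a (vt ((i, j), false) 1) = false := hMf (i+1) j (by omega)
    simp [h, e, h1, h2]
  have hv : ∀ i j, (i ≤ -M ∨ M ≤ i ∨ j + 1 ≤ -M ∨ M ≤ j) → v i j = false := by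
    intro i j hij
    have h1 : a (vt ((i, j), true) 0) = false := hMf i j (by omega)
    have h2 : a (vt ((i, j), true) 1) = false := hMf i (j+1) (by omega)
    simp [v, e, h1, h2]
  let b : ℤ × ℤ → Bool := fun p => BB h M (p.1 + M).toNat p.2
  have bh : ∀ i j, (b (i, j) ^^ b (i + 1, j)) = h i j := by
    intro i j
    simp only [b]
    rcases lt_or_ge i (-M) with hi | hi
    · rw [show (i + M).toNat = 0 by omega, show (i + 1 + M).toNat = 0 by omega, hh i j (by omega)]
      rfl
    · rw [show (i + 1 + M).toNat = (i + M).toNat + 1 by omega]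
      simp only [BB]
      rw [show (-M + ((i + M).toNat : ℤ)) = i by omega]
      simp
  have Bv : ∀ n : ℕ, ∀ j, (BB h M n j ^^ BB h M n (j + 1)) = v (-M + n) j := by
    intro n
    induction n with
    | zero => intro j; rw [hv _ _ (by left; simp)]; rfl
    | succ n ih =>
      intro j
      have h1 := ih j
      have h2 := hsq (-M + n) j
      simp only [BB]
      rw [show (-M + ((n + 1 : ℕ) : ℤ)) = -M + n + 1 by push_cast; ring]
      revert h1 h2
      generalize BB h M n j = x1
      generalize BB h M n (j+1) = x2
      generalize h (-M + n) j = x3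
      generalize h (-M + n) (j+1) = x4
      generalize v (-M + n) j = x5
      generalize v (-M + n + 1) j = x6
      revert x1 x2 x3 x4 x5 x6
      decide
  have bv : ∀ i j, (b (i, j) ^^ b (i, j + 1)) = v i j := by
    intro i j
    simp only [b]
    rcases lt_or_ge i (-M) with hi | hi
    · rw [show (i + M).toNat = 0 by omega, hv i j (by omega)]
      rfl
    · rw [Bv, show (-M + ((i + M).toNat : ℤ)) = i by omega]
  have bout : ∀ n : ℕ, ∀ j, (j ≤ -M ∨ M ≤ j) → BB h M n j = false := by
    intro n j hj
    induction n with
    | zero => rfl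
    | succ n ih => simp only [BB]; rw [ih, hh _ _ (by omega)]; rfl
  have btri : ∀ T m n, (b (vt T m) ^^ b (vt T n)) = e T m n := by
    have b01 : ∀ T, (b (vt T 0) ^^ b (vt T 1)) = e T 0 1 := by
      rintro ⟨⟨i, j⟩, _ | _⟩
      · exact bh i j
      · exact bv i j
    have b12 : ∀ T, (b (vt T 1) ^^ b (vt T 2)) = e T 1 2 := by
      rintro ⟨⟨i, j⟩, _ | _⟩
      · exact (bv (i+1) j).trans (he _ _ _ _ _ _ rfl rfl)
      · exact (bh i (j+1)).trans (he _ _ _ _ _ _ rfl rfl)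
    intro T m n
    have esymm : ∀ m n, e T m n = e T n m := by
      intro m n; simp only [e, Bool.xor_comm]
    have eself : ∀ m, e T m m = false := by intro m; simp [e]
    have h1 := b01 T
    have h2 := b12 T
    have h3 := hadd T 0 1 2
    have h02 : (b (vt T 0) ^^ b (vt T 2)) = e T 0 2 := by
      rw [← h3, ← h1, ← h2]; simp
    fin_cases m <;> fin_cases n <;>
      simp only [Fin.zero_eta, Fin.mk_one, Fin.reduceFinMk, Bool.xor_self, eself, h1, h2, h02,
        Bool.xor_comm (b (vt T 1)) (b (vt T 0)), Bool.xor_comm (b (vt T 2)) (b (vt T 0)),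
        Bool.xor_comm (b (vt T 2)) (b (vt T 1)), esymm 1 0, esymm 2 0, esymm 2 1]
  refine ⟨b, ?_, ?_, ?_⟩
  · apply ((Set.finite_Icc (-M) M).prod (Set.finite_Icc (-M) M)).subset
    rintro ⟨i, j⟩ hij
    by_contra hc
    have hc' : i < -M ∨ M < i ∨ j < -M ∨ M < j := by
      simp only [mem_prod, mem_Icc] at hc
      omega
    have hij : b (i, j) = true := hij
    rcases hc' with h1 | h1 | h1 | h1
    · simp only [b] at hij
      rw [show (i + M).toNat = 0 by omega] at hij
      simp [BB] at hij
    · have hk : ∀ k : ℕ, b (i, M - k) = false := by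
        intro k
        induction k with
        | zero => exact bout _ _ (by omega)
        | succ k ih =>
          have h2 := bv i (M - (k + 1 : ℕ))
          rw [hv _ _ (by omega)] at h2
          rw [show M - ((k + 1 : ℕ) : ℤ) + 1 = M - k by push_cast; ring, ih] at h2
          simpa using h2
      rcases lt_or_ge j M with hj | hj
      · have := hk (M - j).toNat
        rw [show M - ((M - j).toNat : ℤ) = j by omega] at this
        simp [this] at hij
      · simp only [b] at hij
        rw [bout _ _ (by omega)] at hij; simp at hij
    · simp only [b] at hij
      rw [bout _ _ (by omega)] at hij; simp at hij
    · simp only [b] at hij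
      rw [bout _ _ (by omega)] at hij; simp at hij
  · intro T hT m n
    rw [btri]; simp [e, hT]
  · intro T hT m n
    have := btri T m n
    simp only [e, hT, if_false] at this
    simpa using this

end HC

open MeasureTheory Set Filter
open scoped ENNReal NNReal

namespace HC

noncomputable def hat (a b : ℝ) : ℝ := max 0 (1 - max |a| (max |b| |a - b|))

lemma hat_zero {a b : ℝ} (h : 1 ≤ |a| ∨ 1 ≤ |b| ∨ 1 ≤ |a - b|) : hat a b = 0 := by
  unfold hat
  apply max_eq_left
  rcases h with h | h | h
  · have := le_max_left |a| (max |b| |a - b|); linarith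
  · have := (le_max_left |b| |a - b|).trans (le_max_right |a| (max |b| |a - b|)); linarith
  · have := (le_max_right |b| |a - b|).trans (le_max_right |a| (max |b| |a - b|)); linarith

noncomputable def PP (s : Euc 2) (δ : ℝ) (k : ℤ × ℤ) : Euc 2 :=
  s + (δ * k.1) • e0 + (δ * k.2) • e1

noncomputable def pl (s : Euc 2) (δ c : ℝ) (w : ℤ × ℤ → ℝ) (x : Euc 2) : ℝ :=
  c + ∑ᶠ k : ℤ × ℤ, (w k - c) * hat ((x 0 - s 0) / δ - k.1) ((x 1 - s 1) / δ - k.2)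

/-- barycentric coordinates -/
structure InT (s : Euc 2) (δ : ℝ) (T : Tri) (x : Euc 2) (l : Fin 3 → ℝ) : Prop where
  nn : ∀ i, 0 ≤ l i
  sum : l 0 + l 1 + l 2 = 1
  eq : x = l 0 • PP s δ (vt T 0) + l 1 • PP s δ (vt T 1) + l 2 • PP s δ (vt T 2)

lemma pl_cont (s : Euc 2) (δ c : ℝ) {w : ℤ × ℤ → ℝ} (hw : {k | w k ≠ c}.Finite) :
    Continuous (pl s δ c w) := by
  have : pl s δ c w = fun x => c + ∑ k ∈ hw.toFinset,
      (w k - c) * hat ((x 0 - s 0) / δ - k.1) ((x 1 - s 1) / δ - k.2) := by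
    ext x
    unfold pl
    rw [finsum_eq_sum_of_support_subset]
    intro k hk
    simp only [Function.mem_support, ne_eq, mul_eq_zero, not_or, sub_eq_zero] at hk
    simpa using hk.1
  rw [this]
  unfold hat
  fun_prop

lemma PP0 (s : Euc 2) (δ : ℝ) (k : ℤ × ℤ) : PP s δ k 0 = s 0 + δ * k.1 := by
  simp [PP, e0, e1]
lemma PP1 (s : Euc 2) (δ : ℝ) (k : ℤ × ℤ) : PP s δ k 1 = s 1 + δ * k.2 := by
  simp [PP, e0, e1]

lemma hat_vert {α β : ℝ} (i j : ℤ) (p q : ℤ) (h0 : 0 ≤ β) (h1 : β ≤ α) (h2 : α ≤ 1) :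
    hat (i + α - p) (j + β - q) = if p = i ∧ q = j then 1 - α else
      if p = i + 1 ∧ q = j then α - β else if p = i + 1 ∧ q = j + 1 then β else 0 := by
  split_ifs with g1 g2 g3
  · obtain ⟨rfl, rfl⟩ := g1
    unfold hat
    rw [show (p:ℝ) + α - p = α by ring, show (q:ℝ) + β - q = β by ring, abs_of_nonneg h0,
      abs_of_nonneg (h0.trans h1), abs_of_nonneg (by linarith), max_eq_left (max_le h1 (by linarith)),
      max_eq_right (by linarith)]
  · obtain ⟨rfl, rfl⟩ := g2
    unfold hat
    push_cast
    rw [show (i:ℝ) + α - (i + 1) = -(1 - α) by ring, show (q:ℝ) + β - q = β by ring,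
      show -(1 - α) - β = -(1 - α + β) by ring, abs_neg, abs_neg, abs_of_nonneg h0,
      abs_of_nonneg (by linarith), abs_of_nonneg (by linarith),
      max_eq_right (a := β) (b := 1 - α + β) (by linarith), max_eq_right (a := 1 - α) (b := 1 - α + β) (by linarith),
      max_eq_right (a := 0) (by linarith)]
    ring
  · obtain ⟨rfl, rfl⟩ := g3
    unfold hat
    push_cast
    rw [show (i:ℝ) + α - (i + 1) = -(1 - α) by ring, show (j:ℝ) + β - (j + 1) = -(1 - β) by ring,
      show -(1 - α) - -(1 - β) = α - β by ring, abs_neg, abs_neg, abs_of_nonneg (by linarith),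
      abs_of_nonneg (by linarith), abs_of_nonneg (by linarith),
      max_eq_left (a := 1 - β) (b := α - β) (by linarith), max_eq_right (a := 1 - α) (b := 1 - β) (by linarith),
      max_eq_right (a := 0) (by linarith)]
    ring
  · apply hat_zero
    by_contra hc
    push Not at hc
    obtain ⟨c1, c2, c3⟩ := hc
    rw [abs_lt] at c1 c2 c3
    have p1 : p < i + 2 := by
      have : (p:ℝ) < ((i + 2 : ℤ) : ℝ) := by push_cast; linarith
      exact_mod_cast this
    have p2 : i - 1 < p := by
      have : ((i - 1 : ℤ) : ℝ) < p := by push_cast; linarith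
      exact_mod_cast this
    have q1 : q < j + 2 := by
      have : (q:ℝ) < ((j + 2 : ℤ) : ℝ) := by push_cast; linarith
      exact_mod_cast this
    have q2 : j - 1 < q := by
      have : ((j - 1 : ℤ) : ℝ) < q := by push_cast; linarith
      exact_mod_cast this
    have hp : p = i := by omega
    have hq : q = j + 1 := by omega
    rw [hp, hq] at c3
    push_cast at c3
    linarith [c3.1, c3.2]

lemma hat_symm (a b : ℝ) : hat a b = hat b a := by
  unfold hat
  rw [abs_sub_comm, max_left_comm]

lemma pl_tri {s : Euc 2} {δ c : ℝ} (hδ : 0 < δ) (w : ℤ × ℤ → ℝ)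
    {T : Tri} {x : Euc 2} {l : Fin 3 → ℝ} (h : InT s δ T x l) :
    pl s δ c w x = l 0 * w (vt T 0) + l 1 * w (vt T 1) + l 2 * w (vt T 2) := by
  have hhat : ∀ k : ℤ × ℤ, hat ((x 0 - s 0) / δ - k.1) ((x 1 - s 1) / δ - k.2) =
      if k = vt T 0 then l 0 else if k = vt T 1 then l 1 else if k = vt T 2 then l 2 else 0 := by
    rintro ⟨p, q⟩
    obtain ⟨⟨i, j⟩, σ⟩ := T
    have n0 := h.nn 0
    have n1 := h.nn 1
    have n2 := h.nn 2
    have hs := h.sum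
    have hl0 : l 0 = 1 - l 1 - l 2 := by linarith
    have x0 : x 0 = _ := congrArg (fun v : Euc 2 => v 0) h.eq
    have x1 : x 1 = _ := congrArg (fun v : Euc 2 => v 1) h.eq
    simp only [PiLp.add_apply, PiLp.smul_apply, smul_eq_mul, PP0, PP1] at x0 x1
    cases σ
    · have y0 : (x 0 - s 0) / δ = i + (l 1 + l 2) := by
        rw [x0]; simp [vt, hl0]; field_simp; ring
      have y1 : (x 1 - s 1) / δ = j + l 2 := by
        rw [x1]; simp [vt, hl0]; field_simp; ring
      rw [y0, y1, hat_vert i j p q n2 (by linarith) (by linarith)]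
      simp only [vt, Prod.mk.injEq, Matrix.cons_val_zero, Matrix.cons_val_one, Matrix.cons_val]
      rw [show 1 - (l 1 + l 2) = l 0 by linarith, show l 1 + l 2 - l 2 = l 1 by ring]
    · have y0 : (x 0 - s 0) / δ = i + l 2 := by
        rw [x0]; simp [vt, hl0]; field_simp; ring
      have y1 : (x 1 - s 1) / δ = j + (l 1 + l 2) := by
        rw [x1]; simp [vt, hl0]; field_simp; ring
      rw [y0, y1, hat_symm, hat_vert j i q p n2 (by linarith) (by linarith)]
      simp only [vt, Prod.mk.injEq, Matrix.cons_val_zero, Matrix.cons_val_one, Matrix.cons_val]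
      rw [show 1 - (l 1 + l 2) = l 0 by linarith, show l 1 + l 2 - l 2 = l 1 by ring]
      simp only [and_comm]
  have d01 : vt T 0 ≠ vt T 1 := by
    obtain ⟨⟨i, j⟩, _ | _⟩ := T <;> simp [vt]
  have d02 : vt T 0 ≠ vt T 2 := by
    obtain ⟨⟨i, j⟩, _ | _⟩ := T <;> simp [vt]
  have d12 : vt T 1 ≠ vt T 2 := by
    obtain ⟨⟨i, j⟩, _ | _⟩ := T <;> simp [vt]
  unfold pl
  rw [finsum_eq_sum_of_support_subset (s := {vt T 0, vt T 1, vt T 2})]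
  · rw [Finset.sum_insert (by simp [d01, d02]), Finset.sum_insert (by simp [d12]), Finset.sum_singleton,
      hhat, hhat, hhat]
    simp only [d01.symm, d02.symm, d12.symm, if_true, if_false]
    have := h.sum
    linear_combination (-c) * this
  · intro k hk
    simp only [Function.mem_support, hhat, ne_eq, mul_eq_zero, not_or] at hk
    have h2 := hk.2
    simp only [Finset.coe_insert, Finset.coe_singleton, mem_insert_iff, mem_singleton_iff]
    by_contra hc
    push Not at hc
    simp [hc] at h2

lemma exists_tri (s : Euc 2) {δ : ℝ} (hδ : 0 < δ) (x : Euc 2) : ∃ T l, InT s δ T x l := by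
  set a := (x 0 - s 0) / δ with ha
  set b := (x 1 - s 1) / δ with hb
  have ha' : x 0 = s 0 + δ * a := by rw [ha]; field_simp; ring
  have hb' : x 1 = s 1 + δ * b := by rw [hb]; field_simp; ring
  set α := Int.fract a
  set β := Int.fract b
  have hα0 : 0 ≤ α := Int.fract_nonneg a
  have hβ0 : 0 ≤ β := Int.fract_nonneg b
  have hα1 : α < 1 := Int.fract_lt_one a
  have hβ1 : β < 1 := Int.fract_lt_one b
  have ea : a = ⌊a⌋ + α := (Int.floor_add_fract a).symm
  have eb : b = ⌊b⌋ + β := (Int.floor_add_fract b).symm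
  rcases le_total β α with h | h
  · refine ⟨((⌊a⌋, ⌊b⌋), false), ![1 - α, α - β, β], ⟨?_, ?_, ?_⟩⟩
    · intro i; fin_cases i <;> simp <;> linarith
    · simp
    · ext i
      fin_cases i
      · show x 0 = _
        simp only [PiLp.add_apply, PiLp.smul_apply, smul_eq_mul, Fin.zero_eta, PP0]
        rw [ha']
        simp [vt]
        linear_combination δ * ea
      · show x 1 = _
        simp only [PiLp.add_apply, PiLp.smul_apply, smul_eq_mul, Fin.mk_one, PP1]
        rw [hb']
        simp [vt]
        linear_combination δ * eb
  · refine ⟨((⌊a⌋, ⌊b⌋), true), ![1 - β, β - α, α], ⟨?_, ?_, ?_⟩⟩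
    · intro i; fin_cases i <;> simp <;> linarith
    · simp
    · ext i
      fin_cases i
      · show x 0 = _
        simp only [PiLp.add_apply, PiLp.smul_apply, smul_eq_mul, Fin.zero_eta, PP0]
        rw [ha']
        simp [vt]
        linear_combination δ * ea
      · show x 1 = _
        simp only [PiLp.add_apply, PiLp.smul_apply, smul_eq_mul, Fin.mk_one, PP1]
        rw [hb']
        simp [vt]
        linear_combination δ * eb

end HC

open MeasureTheory Set Filter
open scoped ENNReal NNReal

namespace HC

def Z3 (P0 P1 P2 : Euc 2) (w0 w1 w2 : ℝ) : Set (Euc 2) :=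
  {x | ∃ a b c : ℝ, 0 ≤ a ∧ 0 ≤ b ∧ 0 ≤ c ∧ a + b + c = 1 ∧ x = a • P0 + b • P1 + c • P2 ∧
    a * w0 + b * w1 + c * w2 = 0}

lemma Z3_neg (P0 P1 P2 : Euc 2) (w0 w1 w2 : ℝ) :
    Z3 P0 P1 P2 (-w0) (-w1) (-w2) = Z3 P0 P1 P2 w0 w1 w2 := by
  ext x
  constructor <;> rintro ⟨a, b, c, ha, hb, hc, hs, hx, hw⟩ <;>
    exact ⟨a, b, c, ha, hb, hc, hs, hx, by linarith⟩

lemma Z3_swap (P0 P1 P2 : Euc 2) (w0 w1 w2 : ℝ) :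
    Z3 P0 P1 P2 w0 w1 w2 = Z3 P1 P0 P2 w1 w0 w2 := by
  ext x
  constructor <;> rintro ⟨a, b, c, ha, hb, hc, hs, hx, hw⟩ <;>
    exact ⟨b, a, c, hb, ha, hc, by linarith, by rw [hx]; abel, by linarith⟩

lemma Z3_swap' (P0 P1 P2 : Euc 2) (w0 w1 w2 : ℝ) :
    Z3 P0 P1 P2 w0 w1 w2 = Z3 P2 P1 P0 w2 w1 w0 := by
  ext x
  constructor <;> rintro ⟨a, b, c, ha, hb, hc, hs, hx, hw⟩ <;>
    exact ⟨c, b, a, hc, hb, ha, by linarith, by rw [hx]; abel, by linarith⟩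

lemma Z3_seg_aux (P0 P1 P2 : Euc 2) {w0 w1 w2 : ℝ} (h0 : w0 < 0) (h1 : 0 < w1) (h2 : 0 < w2) :
    ∃ p q, Z3 P0 P1 P2 w0 w1 w2 = segment ℝ p q := by
  have g1 : 0 < w1 - w0 := by linarith
  have g2 : 0 < w2 - w0 := by linarith
  have n0 : 0 < -w0 := by linarith
  have nz : w0 ≠ 0 := h0.ne
  refine ⟨(w1 / (w1 - w0)) • P0 + (-w0 / (w1 - w0)) • P1,
    (w2 / (w2 - w0)) • P0 + (-w0 / (w2 - w0)) • P2, ?_⟩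
  ext x
  constructor
  · rintro ⟨a, b, c, ha, hb, hc, hs, hx, hw⟩
    refine ⟨b * (w1 - w0) / (-w0), c * (w2 - w0) / (-w0), by positivity, by positivity, ?_, ?_⟩
    · have : b * (w1 - w0) + c * (w2 - w0) = -w0 := by linear_combination hw - w0 * hs
      rw [← add_div, this, div_self n0.ne']
    · have ha' : a = b * w1 / (-w0) + c * w2 / (-w0) := by
        rw [← add_div, eq_div_iff n0.ne']; linear_combination -hw
      rw [hx, smul_add, smul_add, smul_smul, smul_smul, smul_smul, smul_smul,
        show b * (w1 - w0) / -w0 * (w1 / (w1 - w0)) = b * w1 / (-w0) by field_simp,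
        show c * (w2 - w0) / -w0 * (w2 / (w2 - w0)) = c * w2 / (-w0) by field_simp,
        show b * (w1 - w0) / -w0 * (-w0 / (w1 - w0)) = b by field_simp,
        show c * (w2 - w0) / -w0 * (-w0 / (w2 - w0)) = c by field_simp, ha', add_smul]
      abel
  · rintro ⟨u, v, hu, hv, huv, hx⟩
    refine ⟨u * (w1 / (w1 - w0)) + v * (w2 / (w2 - w0)), u * (-w0 / (w1 - w0)),
      v * (-w0 / (w2 - w0)), by positivity, by positivity, by positivity, ?_, ?_, ?_⟩
    · have e1 : w1 / (w1 - w0) + -w0 / (w1 - w0) = 1 := by field_simp; ring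
      have e2 : w2 / (w2 - w0) + -w0 / (w2 - w0) = 1 := by field_simp; ring
      linear_combination u * e1 + v * e2 + huv
    · rw [← hx, smul_add, smul_add, smul_smul, smul_smul, smul_smul, smul_smul, add_smul]
      abel
    · field_simp
      ring

lemma Z3_seg (P0 P1 P2 : Euc 2) {w0 w1 w2 : ℝ} (h1 : w0 * w1 < 0) (h2 : w0 * w2 < 0) :
    ∃ p q, Z3 P0 P1 P2 w0 w1 w2 = segment ℝ p q := by
  rcases lt_trichotomy w0 0 with h | h | h
  · exact Z3_seg_aux _ _ _ h (pos_of_mul_neg_right h1 h.le) (pos_of_mul_neg_right h2 h.le)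
  · simp [h] at h1
  · rw [← Z3_neg]
    have a1 := neg_of_mul_neg_right h1 h.le
    have a2 := neg_of_mul_neg_right h2 h.le
    exact Z3_seg_aux _ _ _ (by linarith) (by linarith) (by linarith)

def ZT (s : Euc 2) (δ : ℝ) (w : ℤ × ℤ → ℝ) (T : Tri) : Set (Euc 2) :=
  Z3 (PP s δ (vt T 0)) (PP s δ (vt T 1)) (PP s δ (vt T 2)) (w (vt T 0)) (w (vt T 1)) (w (vt T 2))

lemma mem_ZT {s : Euc 2} {δ : ℝ} {w : ℤ × ℤ → ℝ} {T : Tri} {x : Euc 2} :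
    x ∈ ZT s δ w T ↔ ∃ l, InT s δ T x l ∧
      l 0 * w (vt T 0) + l 1 * w (vt T 1) + l 2 * w (vt T 2) = 0 := by
  constructor
  · rintro ⟨a, b, c, ha, hb, hc, hs, hx, hw⟩
    refine ⟨![a, b, c], ⟨?_, by simpa using hs, by simpa using hx⟩, by simpa using hw⟩
    intro i; fin_cases i <;> simpa
  · rintro ⟨l, h, hw⟩
    exact ⟨l 0, l 1, l 2, h.nn 0, h.nn 1, h.nn 2, h.sum, h.eq, hw⟩

def wt (m : ℤ × ℤ → ℝ) (a : ℤ × ℤ → Bool) (v : ℤ × ℤ) : ℝ := if a v then m v else -m v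

def crossed (a : ℤ × ℤ → Bool) (T : Tri) : Prop := ∃ i j, a (vt T i) ≠ a (vt T j)

lemma wt_mul_neg {m : ℤ × ℤ → ℝ} (hm : ∀ v, 0 < m v) {a : ℤ × ℤ → Bool} {v v' : ℤ × ℤ}
    (h : a v ≠ a v') : wt m a v * wt m a v' < 0 := by
  have := mul_pos (hm v) (hm v')
  unfold wt
  cases h1 : a v <;> cases h2 : a v' <;> simp_all

lemma ZT_seg (s : Euc 2) (δ : ℝ) {m : ℤ × ℤ → ℝ} (hm : ∀ v, 0 < m v) {a : ℤ × ℤ → Bool} {T : Tri}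
    (h : crossed a T) : ∃ p q, ZT s δ (wt m a) T = segment ℝ p q := by
  have key : (a (vt T 0) ≠ a (vt T 1) ∧ a (vt T 0) ≠ a (vt T 2)) ∨
      (a (vt T 1) ≠ a (vt T 0) ∧ a (vt T 1) ≠ a (vt T 2)) ∨
      (a (vt T 2) ≠ a (vt T 1) ∧ a (vt T 2) ≠ a (vt T 0)) := by
    obtain ⟨i, j, hij⟩ := h
    by_cases h01 : a (vt T 0) = a (vt T 1) <;> by_cases h02 : a (vt T 0) = a (vt T 2) <;>
      by_cases h12 : a (vt T 1) = a (vt T 2) <;> fin_cases i <;> fin_cases j <;> simp_all <;> grind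
  unfold ZT
  rcases key with ⟨h1, h2⟩ | ⟨h1, h2⟩ | ⟨h1, h2⟩
  · exact Z3_seg _ _ _ (wt_mul_neg hm h1) (wt_mul_neg hm h2)
  · rw [Z3_swap]
    exact Z3_seg _ _ _ (wt_mul_neg hm h1) (wt_mul_neg hm h2)
  · rw [Z3_swap']
    exact Z3_seg _ _ _ (wt_mul_neg hm h1) (wt_mul_neg hm h2)

lemma ZT_inv (s : Euc 2) (δ : ℝ) (m : ℤ × ℤ → ℝ) {a b : ℤ × ℤ → Bool} {T : Tri}
    (h : ∀ i j, (b (vt T i) ^^ b (vt T j)) = (a (vt T i) ^^ a (vt T j))) :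
    ZT s δ (wt m b) T = ZT s δ (wt m a) T := by
  by_cases h0 : b (vt T 0) = a (vt T 0)
  · have h1 : ∀ i, b (vt T i) = a (vt T i) := by
      intro i
      have := h 0 i
      rw [h0] at this
      simpa using this
    simp only [ZT, wt, h1]
  · have h1 : ∀ i, b (vt T i) = !a (vt T i) := by
      intro i
      have := h 0 i
      revert h0 this
      cases b (vt T 0) <;> cases a (vt T 0) <;> cases b (vt T i) <;> cases a (vt T i) <;> simp
    have h2 : ∀ i, wt m b (vt T i) = -wt m a (vt T i) := by
      intro i
      simp only [wt, h1]
      cases a (vt T i) <;> simp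
    simp only [ZT, h2, Z3_neg]

lemma edge_mem (s : Euc 2) (δ : ℝ) (w : ℤ × ℤ → ℝ) {T : Tri} {i j : Fin 3}
    (h : w (vt T i) * w (vt T j) < 0) :
    (w (vt T j) / (w (vt T j) - w (vt T i))) • PP s δ (vt T i) +
      (-w (vt T i) / (w (vt T j) - w (vt T i))) • PP s δ (vt T j) ∈ ZT s δ w T := by
  have hij : i ≠ j := by
    rintro rfl
    nlinarith
  set u := w (vt T i)
  set v := w (vt T j)
  have hd : v - u ≠ 0 := by
    intro h0
    have : v = u := by linarith
    rw [this] at h; nlinarith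
  have p1 : 0 ≤ v / (v - u) := by
    rw [← mul_div_mul_right _ _ hd]
    exact div_nonneg (by nlinarith [sq_nonneg v]) (mul_self_nonneg _)
  have p2 : 0 ≤ -u / (v - u) := by
    rw [← mul_div_mul_right _ _ hd]
    exact div_nonneg (by nlinarith [sq_nonneg u]) (mul_self_nonneg _)
  have p3 : v / (v - u) + -u / (v - u) = 1 := by field_simp; ring
  have p4 : v / (v - u) * u + -u / (v - u) * v = 0 := by field_simp; ring
  rw [mem_ZT]
  refine ⟨fun k => if k = i then v / (v - u) else if k = j then -u / (v - u) else 0, ⟨?_, ?_, ?_⟩, ?_⟩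
  · intro k
    split_ifs <;> first | assumption | rfl
  · fin_cases i <;> fin_cases j <;> simp at hij ⊢ <;> linarith
  · fin_cases i <;> fin_cases j <;> simp at hij ⊢ <;> abel
  · fin_cases i <;> fin_cases j <;> simp at hij ⊢ <;> simp only [u, v] at p4 ⊢ <;> simpa [add_comm] using p4

lemma ZT_adj (s : Euc 2) (δ : ℝ) {m : ℤ × ℤ → ℝ} (hm : ∀ v, 0 < m v) {a : ℤ × ℤ → Bool} {T T' : Tri}
    {i j i' j' : Fin 3} (h1 : vt T i = vt T' i') (h2 : vt T j = vt T' j')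
    (h : a (vt T i) ≠ a (vt T j)) : (ZT s δ (wt m a) T ∩ ZT s δ (wt m a) T').Nonempty := by
  have e1 := edge_mem s δ (wt m a) (wt_mul_neg hm h)
  have h' := h
  rw [h1, h2] at h'
  have e2 := edge_mem s δ (wt m a) (wt_mul_neg hm h')
  rw [← h1, ← h2] at e2
  exact ⟨_, e1, e2⟩

/-! level sets -/

def UU (s : Euc 2) (δ t : ℝ) (w : ℤ × ℤ → ℝ) : Set (Euc 2) := {x | 0 < pl s δ (-t) w x}

lemma wt_fin {m : ℤ × ℤ → ℝ} {t : ℝ} (hm : {v | m v ≠ t}.Finite) {a : ℤ × ℤ → Bool}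
    (ha : {v | a v = true}.Finite) : {v | wt m a v ≠ -t}.Finite := by
  refine (hm.union ha).subset ?_
  intro v hv
  by_contra hc
  simp only [mem_union, mem_ofPred_eq, not_or, not_not] at hc
  apply hv
  simp [wt, hc]

lemma zero_crossed {s : Euc 2} {δ : ℝ} {m : ℤ × ℤ → ℝ} (hm : ∀ v, 0 < m v) {a : ℤ × ℤ → Bool}
    {T : Tri} {x : Euc 2} {l : Fin 3 → ℝ} (h : InT s δ T x l)
    (h0 : l 0 * wt m a (vt T 0) + l 1 * wt m a (vt T 1) + l 2 * wt m a (vt T 2) = 0) :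
    crossed a T := by
  by_contra hc
  unfold crossed at hc
  push Not at hc
  have n0 := h.nn 0
  have n1 := h.nn 1
  have n2 := h.nn 2
  have hs := h.sum
  have pos : 0 < l 0 * m (vt T 0) + l 1 * m (vt T 1) + l 2 * m (vt T 2) := by
    have q0 := mul_nonneg n0 (hm (vt T 0)).le
    have q1 := mul_nonneg n1 (hm (vt T 1)).le
    have q2 := mul_nonneg n2 (hm (vt T 2)).le
    by_contra hneg
    have z0 : l 0 = 0 := by
      have : l 0 * m (vt T 0) = 0 := by linarith
      exact (mul_eq_zero.1 this).resolve_right (hm _).ne'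
    have z1 : l 1 = 0 := by
      have : l 1 * m (vt T 1) = 0 := by linarith
      exact (mul_eq_zero.1 this).resolve_right (hm _).ne'
    have z2 : l 2 = 0 := by
      have : l 2 * m (vt T 2) = 0 := by linarith
      exact (mul_eq_zero.1 this).resolve_right (hm _).ne'
    rw [z0, z1, z2] at hs; norm_num at hs
  have a1 := hc 1 0
  have a2 := hc 2 0
  unfold wt at h0
  rw [a1, a2] at h0
  cases h3 : a (vt T 0) <;> simp [h3] at h0 <;> linarith

lemma exists_pos_vert {s : Euc 2} {δ : ℝ} {w : ℤ × ℤ → ℝ} {T : Tri} {x : Euc 2} {l : Fin 3 → ℝ}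
    (h : InT s δ T x l) (h0 : 0 < l 0 * w (vt T 0) + l 1 * w (vt T 1) + l 2 * w (vt T 2)) :
    ∃ i, 0 < w (vt T i) := by
  by_contra hc
  push Not at hc
  have := mul_nonpos_of_nonneg_of_nonpos (h.nn 0) (hc 0)
  have := mul_nonpos_of_nonneg_of_nonpos (h.nn 1) (hc 1)
  have := mul_nonpos_of_nonneg_of_nonpos (h.nn 2) (hc 2)
  linarith

lemma frontier_UU (s : Euc 2) {δ t : ℝ} (hδ : 0 < δ) {m : ℤ × ℤ → ℝ} (hmp : ∀ v, 0 < m v)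
    (hm : {v | m v ≠ t}.Finite) {a : ℤ × ℤ → Bool} (ha : {v | a v = true}.Finite) :
    frontier (UU s δ t (wt m a)) = ⋃ T ∈ {T | crossed a T}, ZT s δ (wt m a) T := by
  have hcont := pl_cont s δ (-t) (wt_fin hm ha)
  have hop : IsOpen (UU s δ t (wt m a)) := isOpen_lt continuous_const hcont
  ext x
  simp only [mem_iUnion, exists_prop, mem_ofPred_eq]
  constructor
  · intro hx
    have h0 : 0 = pl s δ (-t) (wt m a) x := frontier_lt_subset_eq continuous_const hcont hx
    obtain ⟨T, l, h⟩ := exists_tri s hδ x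
    rw [pl_tri hδ _ h] at h0
    exact ⟨T, zero_crossed hmp h h0.symm, mem_ZT.2 ⟨l, h, h0.symm⟩⟩
  · rintro ⟨T, hT, hx⟩
    obtain ⟨l, h, h0⟩ := mem_ZT.1 hx
    rw [hop.frontier_eq]
    refine ⟨?_, ?_⟩
    · -- positive vertex
      obtain ⟨k, hk⟩ : ∃ k, 0 < wt m a (vt T k) := by
        obtain ⟨i, j, hij⟩ := hT
        cases hi : a (vt T i)
        · refine ⟨j, ?_⟩
          have : a (vt T j) = true := by
            rw [hi] at hij; simpa using hij.symm
          simp [wt, this, hmp]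
        · exact ⟨i, by simp [wt, hi, hmp]⟩
      have hlim : Tendsto (fun n : ℕ => x + (1 / ((n:ℝ) + 1)) • (PP s δ (vt T k) - x)) atTop (nhds x) := by
        have := (tendsto_one_div_add_atTop_nhds_zero_nat (𝕜 := ℝ)).smul_const (PP s δ (vt T k) - x)
        simpa using this.const_add x
      refine mem_closure_of_tendsto hlim (Eventually.of_forall fun n => ?_)
      set ε : ℝ := 1 / ((n:ℝ) + 1)
      have e0 : 0 < ε := by positivity
      have e1 : ε ≤ 1 := by
        rw [div_le_one (by positivity)]; linarith [Nat.cast_nonneg (α := ℝ) n]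
      have hIn : InT s δ T (x + ε • (PP s δ (vt T k) - x))
          (fun i => (1 - ε) * l i + ε * (if i = k then 1 else 0)) := by
        refine ⟨fun i => ?_, ?_, ?_⟩
        · have := mul_nonneg (by linarith : 0 ≤ 1 - ε) (h.nn i)
          split_ifs <;> linarith
        · have := h.sum
          fin_cases k <;> simp <;> linear_combination (1 - ε) * this
        · have hx' : x + ε • (PP s δ (vt T k) - x) = (1 - ε) • x + ε • PP s δ (vt T k) := by
            module
          rw [hx', h.eq]
          fin_cases k <;> simp <;> module
      show 0 < pl s δ (-t) (wt m a) _
      rw [pl_tri hδ _ hIn]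
      have : 0 < ε * wt m a (vt T k) := mul_pos e0 hk
      fin_cases k <;> simp at this ⊢ <;> linear_combination this - (1 - ε) * h0
    · intro hU
      have : 0 < pl s δ (-t) (wt m a) x := hU
      rw [pl_tri hδ _ h] at this
      linarith

end HC

open MeasureTheory Set Filter
open scoped ENNReal NNReal

namespace HC

def Loop (S : Set (Euc 2)) : Prop := ∃ p, ∃ γ : Path p p, range γ = S

lemma Loop.rebase {S : Set (Euc 2)} (h : Loop S) {x : Euc 2} (hx : x ∈ S) :
    ∃ γ : Path x x, range γ = S := by
  obtain ⟨p, γ, hγ⟩ := h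
  rw [← hγ] at hx
  obtain ⟨t, rfl⟩ := hx
  let α : Path p (γ t) := (γ.subpath 0 t).cast γ.source.symm rfl
  have hα : range α ⊆ S := by
    have : range α = γ '' (uIcc 0 t) := by
      rw [← Path.range_subpath]; rfl
    rw [this, ← hγ]; exact image_subset_range _ _
  refine ⟨(α.symm.trans γ).trans α, ?_⟩
  rw [Path.trans_range, Path.trans_range, Path.symm_range, hγ, union_eq_right.2 hα, union_eq_left.2 hα]

lemma loop_segment (p q : Euc 2) : Loop (segment ℝ p q) := by
  refine ⟨p, (Path.segment p q).trans (Path.segment p q).symm, ?_⟩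
  rw [Path.trans_range, Path.symm_range, union_self, Path.range_segment]

lemma loop_union {S T : Set (Euc 2)} (hS : Loop S) (hT : Loop T) (h : (S ∩ T).Nonempty) :
    Loop (S ∪ T) := by
  obtain ⟨x, hx, hy⟩ := h
  obtain ⟨γ, hγ⟩ := hS.rebase hx
  obtain ⟨γ', hγ'⟩ := hT.rebase hy
  exact ⟨x, γ.trans γ', by rw [Path.trans_range, hγ, hγ']⟩

lemma adm {C : Set (Euc 2)} (hC : Good C) {U : Set (Euc 2)} (hU : IsOpen U) (hcl : closure U ⊆ C)
    (hL : Loop (frontier U)) (hfin : hausD 1 (hDist C) (frontier U) < ⊤) :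
    ENNReal.ofReal (cheeger2 C) * hMeasure C U ≤ hausD 1 (hDist C) (frontier U) := by
  rcases eq_or_ne U ∅ with rfl | hne
  · simp
  have hcpt : IsCompact (closure U) :=
    Metric.isCompact_of_isClosed_isBounded isClosed_closure (hC.bdd.subset hcl)
  have hμ : hMeasure C U < ⊤ := (measure_mono subset_closure).trans_lt (hMeasure_compact hC hcpt hcl)
  have hle : cheeger2 C ≤ (hausD 1 (hDist C) (frontier U)).toReal / (hMeasure C U).toReal := by
    refine csInf_le ⟨0, ?_⟩ ⟨U, hU, nonempty_iff_ne_empty.2 hne, hcl, ?_, rfl⟩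
    · rintro r ⟨V, -, -, -, -, rfl⟩
      positivity
    · obtain ⟨p, γ, hγ⟩ := hL
      refine ⟨γ.extend, γ.continuous_extend.continuousOn, ?_, by simp, hfin⟩
      rw [← hγ]
      ext y
      constructor
      · rintro ⟨t, ht, rfl⟩
        exact ⟨⟨t, ht⟩, by rw [γ.extend_apply ht]⟩
      · rintro ⟨t, rfl⟩
        exact ⟨t, t.2, by simp⟩
  rcases eq_or_ne (hMeasure C U) 0 with h0 | h0
  · simp [h0]
  have hpos : 0 < (hMeasure C U).toReal := ENNReal.toReal_pos h0 hμ.ne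
  rw [le_div_iff₀ hpos] at hle
  rw [← ENNReal.ofReal_toReal hμ.ne, ← ENNReal.ofReal_toReal hfin.ne, ← ENNReal.ofReal_mul' hpos.le]
  exact ENNReal.ofReal_le_ofReal hle

lemma sub_of_frontier {U K : Set (Euc 2)} (hU : IsOpen U) (hb : Bornology.IsBounded U)
    (hKc : Convex ℝ K) (hK : IsCompact K) (hKn : K.Nonempty) (h : frontier U ⊆ K) : U ⊆ K := by
  intro x hx
  by_contra hxK
  obtain ⟨f, u, hf, hu⟩ := geometric_hahn_banach_closed_point hKc hK.isClosed hxK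
  have hcpt : IsCompact (closure U) :=
    Metric.isCompact_of_isClosed_isBounded isClosed_closure hb.closure
  obtain ⟨y, hy, hmax⟩ := hcpt.exists_isMaxOn ⟨x, subset_closure hx⟩ f.continuous.continuousOn
  have hyx : f x ≤ f y := hmax (subset_closure hx)
  by_cases hyU : y ∈ U
  · have hloc : IsLocalMax f y := by
      filter_upwards [hU.mem_nhds hyU] with z hz using hmax (subset_closure hz)
    have h0 := hloc.fderiv_eq_zero
    rw [ContinuousLinearMap.fderiv] at h0
    obtain ⟨k, hk⟩ := hKn
    have := hf k hk
    simp only [h0, ContinuousLinearMap.zero_apply] at this hu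
    linarith
  · have : y ∈ frontier U := by rw [hU.frontier_eq]; exact ⟨hy, hyU⟩
    have := hf y (h this)
    linarith

lemma vt_add (T : Tri) (i : Fin 3) : vt T i = T.1 + vt ((0, 0), T.2) i := by
  obtain ⟨⟨p, q⟩, _ | _⟩ := T <;> fin_cases i <;> simp [vt]

lemma touch_finite {S : Set (ℤ × ℤ)} (hS : S.Finite) : {T : Tri | ∃ i, vt T i ∈ S}.Finite := by
  refine ((hS.prod (finite_univ (α := Fin 3 × Bool))).image
    (fun z => ((z.1 - vt ((0, 0), z.2.2) z.2.1, z.2.2) : Tri))).subset ?_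
  rintro T ⟨i, hi⟩
  refine ⟨(vt T i, i, T.2), ⟨hi, mem_univ _⟩, ?_⟩
  simp only [vt_add T i, add_sub_cancel_right]

lemma crossed_finite {a : ℤ × ℤ → Bool} (ha : {v | a v = true}.Finite) : {T | crossed a T}.Finite := by
  refine (touch_finite ha).subset ?_
  rintro T ⟨i, j, hij⟩
  cases hi : a (vt T i)
  · refine ⟨j, ?_⟩
    rw [hi] at hij
    simpa using hij.symm
  · exact ⟨i, hi⟩

lemma eq_false_of_not_crossed {a : ℤ × ℤ → Bool} (ha : {v | a v = true}.Finite)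
    (h : ∀ T, ¬ crossed a T) (v : ℤ × ℤ) : a v = false := by
  by_contra hv
  have hv : a v = true := by simpa using hv
  have step : ∀ n : ℕ, a (v.1 + n, v.2) = true := by
    intro n
    induction n with
    | zero => simpa using hv
    | succ n ih =>
      have := h ((v.1 + n, v.2), false)
      unfold crossed at this
      push Not at this
      have h2 := this 0 1
      simp only [vt, Matrix.cons_val_zero, Matrix.cons_val_one] at h2
      rw [ih] at h2
      push_cast
      rw [← add_assoc]
      exact h2.symm
  refine (infinite_of_injective_forall_mem (f := fun n : ℕ => (v.1 + n, v.2)) ?_ step) ha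
  intro n n' hn
  simpa using hn

lemma PP_dist (s : Euc 2) {δ : ℝ} (hδ : 0 < δ) (T : Tri) (i : Fin 3) :
    dist (PP s δ (vt T i)) (PP s δ T.1) ≤ 2 * δ := by
  have n0 : ‖e0‖ = 1 := by simp [e0]
  have n1 : ‖e1‖ = 1 := by simp [e1]
  rw [dist_eq_norm]
  have : ∃ α β : ℝ, |α| ≤ 1 ∧ |β| ≤ 1 ∧ PP s δ (vt T i) - PP s δ T.1 = (δ * α) • e0 + (δ * β) • e1 := by
    obtain ⟨⟨p, q⟩, _ | _⟩ := T
    · refine ⟨![0, 1, 1] i, ![0, 0, 1] i, ?_, ?_, ?_⟩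
      · fin_cases i <;> simp
      · fin_cases i <;> simp
      · fin_cases i <;> simp [vt, PP] <;> module
    · refine ⟨![0, 0, 1] i, ![0, 1, 1] i, ?_, ?_, ?_⟩
      · fin_cases i <;> simp
      · fin_cases i <;> simp
      · fin_cases i <;> simp [vt, PP] <;> module
  obtain ⟨α, β, ha, hb, he⟩ := this
  rw [he]
  refine (norm_add_le _ _).trans ?_
  rw [norm_smul, norm_smul, n0, n1, Real.norm_eq_abs, Real.norm_eq_abs, abs_mul, abs_mul, abs_of_pos hδ]
  nlinarith

lemma InT_ball {s : Euc 2} {δ : ℝ} (hδ : 0 < δ) {T : Tri} {x : Euc 2} {l : Fin 3 → ℝ}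
    (h : InT s δ T x l) {z : Euc 2} {R : ℝ} (hz : ∀ i, dist (PP s δ (vt T i)) z ≤ R) :
    dist x z ≤ R := by
  have hc : Convex ℝ (Metric.closedBall z R) := convex_closedBall z R
  have : x ∈ Metric.closedBall z R := by
    rw [h.eq]
    have h3 := hc.sum_mem (t := Finset.univ) (w := l) (z := fun i => PP s δ (vt T i))
      (fun i _ => h.nn i) (by rw [Fin.sum_univ_three]; exact h.sum) (fun i _ => hz i)
    rw [Fin.sum_univ_three] at h3
    exact h3
  exact this

lemma InT_dist {s : Euc 2} {δ : ℝ} (hδ : 0 < δ) {T : Tri} {x : Euc 2} {l : Fin 3 → ℝ}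
    (h : InT s δ T x l) : dist x (PP s δ T.1) ≤ 2 * δ :=
  InT_ball hδ h (PP_dist s hδ T)

lemma UU_sub (s : Euc 2) {δ t : ℝ} (hδ : 0 < δ) {m : ℤ × ℤ → ℝ} (hmp : ∀ v, 0 < m v)
    {a : ℤ × ℤ → Bool} {x : Euc 2} (hx : x ∈ UU s δ t (wt m a)) :
    ∃ T l i, InT s δ T x l ∧ a (vt T i) = true := by
  obtain ⟨T, l, h⟩ := exists_tri s hδ x
  have hx : 0 < pl s δ (-t) (wt m a) x := hx
  rw [pl_tri hδ _ h] at hx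
  obtain ⟨i, hi⟩ := exists_pos_vert h hx
  refine ⟨T, l, i, h, ?_⟩
  by_contra hc
  have := hmp (vt T i)
  simp only [wt, hc] at hi
  simp at hi
  linarith

lemma UU_bdd (s : Euc 2) {δ t : ℝ} (hδ : 0 < δ) {m : ℤ × ℤ → ℝ} (hmp : ∀ v, 0 < m v)
    {a : ℤ × ℤ → Bool} (ha : {v | a v = true}.Finite) : Bornology.IsBounded (UU s δ t (wt m a)) := by
  have : UU s δ t (wt m a) ⊆ ⋃ T ∈ {T : Tri | ∃ i, vt T i ∈ {v | a v = true}},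
      Metric.closedBall (PP s δ T.1) (2 * δ) := by
    intro x hx
    obtain ⟨T, l, i, h, hi⟩ := UU_sub s hδ hmp hx
    simp only [mem_iUnion]
    exact ⟨T, ⟨i, hi⟩, InT_dist hδ h⟩
  refine Bornology.IsBounded.subset ?_ this
  exact (Bornology.isBounded_biUnion (touch_finite ha)).2 fun _ _ => Metric.isBounded_closedBall

lemma cr_of (a b : ℤ × ℤ → Bool) (T : Tri)
    (h : ∀ i j, (b (vt T i) ^^ b (vt T j)) = (a (vt T i) ^^ a (vt T j))) :
    crossed b T ↔ crossed a T := by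
  unfold crossed
  have : ∀ x y : Bool, x ≠ y ↔ (x ^^ y) = true := by decide
  simp only [this, h]

lemma pos_mono {s : Euc 2} {δ : ℝ} {m : ℤ × ℤ → ℝ} (hmp : ∀ v, 0 < m v) {a c : ℤ × ℤ → Bool}
    {T : Tri} {x : Euc 2} {l : Fin 3 → ℝ} (h : InT s δ T x l)
    (hc : ∀ i, a (vt T i) = true → c (vt T i) = true)
    (hx : 0 < l 0 * wt m a (vt T 0) + l 1 * wt m a (vt T 1) + l 2 * wt m a (vt T 2)) :
    0 < l 0 * wt m c (vt T 0) + l 1 * wt m c (vt T 1) + l 2 * wt m c (vt T 2) := by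
  have hw : ∀ i, wt m a (vt T i) ≤ wt m c (vt T i) := by
    intro i
    have := hmp (vt T i)
    have hci := hc i
    unfold wt
    cases h1 : a (vt T i)
    · by_cases h2 : c (vt T i) = true
      · simp [h2]; linarith
      · simp [h2]
    · simp [hci h1]
  have := mul_le_mul_of_nonneg_left (hw 0) (h.nn 0)
  have := mul_le_mul_of_nonneg_left (hw 1) (h.nn 1)
  have := mul_le_mul_of_nonneg_left (hw 2) (h.nn 2)
  linarith

set_option maxHeartbeats 1000000 in
open Classical in
theorem decomp_level {C : Set (Euc 2)} (hC : Good C) {K : Set (Euc 2)} (hKc : Convex ℝ K)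
    (hK : IsCompact K) (hKn : K.Nonempty) (hKC : K ⊆ C) (s : Euc 2) {δ t : ℝ} (hδ : 0 < δ)
    {m : ℤ × ℤ → ℝ} (hmp : ∀ v, 0 < m v) (hm : {v | m v ≠ t}.Finite) (L : Tri → ℝ≥0∞)
    (hL : ∀ T, L T < ⊤) (n : ℕ) : ∀ a : ℤ × ℤ → Bool, {v | a v = true}.Finite →
    {T | crossed a T}.ncard = n →
    (∀ T, crossed a T → ZT s δ (wt m a) T ⊆ K ∧ hausD 1 (hDist C) (ZT s δ (wt m a) T) ≤ L T) →
    ENNReal.ofReal (cheeger2 C) * hMeasure C (UU s δ t (wt m a)) ≤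
      ∑' T, if crossed a T then L T else 0 := by
  induction n using Nat.strong_induction_on with
  | _ n ih =>
  intro a ha hn hT
  have hF := crossed_finite ha
  by_cases hex : ∃ T, crossed a T
  swap
  · push Not at hex
    have h0 := eq_false_of_not_crossed ha hex
    have : UU s δ t (wt m a) = ∅ := by
      rw [eq_empty_iff_forall_notMem]
      intro x hx
      obtain ⟨T, l, i, -, hi⟩ := UU_sub s hδ hmp hx
      rw [h0] at hi
      simp at hi
    simp [this]
  obtain ⟨T0, hT0⟩ := hex
  set Fam : Set (Set Tri) := {Q | Q ⊆ {T | crossed a T} ∧ T0 ∈ Q ∧ Loop (⋃ T ∈ Q, ZT s δ (wt m a) T)}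
  have hFam : Fam.Finite := hF.finite_subsets.subset fun Q hQ => hQ.1
  have hloop : ∀ T, crossed a T → Loop (ZT s δ (wt m a) T) := by
    intro T hT
    obtain ⟨p, q, hpq⟩ := ZT_seg s δ hmp hT
    rw [hpq]; exact loop_segment p q
  obtain ⟨Q, ⟨hQF, hQ0, hQL⟩, hQmax⟩ := exists_max_image Fam (fun Q => Q.ncard) hFam
    ⟨{T0}, by simpa using hT0, rfl, by simpa using hloop T0 hT0⟩
  have hQfin : Q.Finite := hF.subset hQF
  have hclosed : ∀ T T' : Tri, ∀ i j i' j' : Fin 3, vt T i = vt T' i' → vt T j = vt T' j' →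
      a (vt T i) ≠ a (vt T j) → T ∈ Q → T' ∈ Q := by
    intro T T' i j i' j' h1 h2 h hTQ
    by_contra hT'
    have hcr : crossed a T' := ⟨i', j', by rwa [← h1, ← h2]⟩
    have hmem : insert T' Q ∈ Fam := by
      refine ⟨insert_subset hcr hQF, mem_insert_of_mem _ hQ0, ?_⟩
      rw [biUnion_insert]
      refine loop_union (hloop T' hcr) hQL ?_
      obtain ⟨x, hx, hx'⟩ := ZT_adj s δ hmp h1 h2 h
      exact ⟨x, hx', mem_biUnion hTQ hx⟩
    have := hQmax _ hmem
    rw [ncard_insert_of_notMem hT' hQfin] at this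
    omega
  obtain ⟨b, hbfin, hbQ, hbQ'⟩ := split_exists a ha Q (by
    intro T T' i j i' j' h1 h2 h
    refine ⟨hclosed T T' i j i' j' h1 h2 h, hclosed T' T i' j' i j h1.symm h2.symm ?_⟩
    rwa [← h1, ← h2])
  set d : ℤ × ℤ → Bool := fun v => a v ^^ b v with hd
  have hdfin : {v | d v = true}.Finite := by
    refine (ha.union hbfin).subset ?_
    intro v hv
    simp only [hd, mem_ofPred_eq, mem_union] at hv ⊢
    revert hv
    cases a v <;> cases b v <;> simp
  have hdQ : ∀ T ∈ Q, ∀ i j, d (vt T i) = d (vt T j) := by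
    intro T hTQ i j
    have := hbQ T hTQ i j
    simp only [hd]
    revert this
    cases b (vt T i) <;> cases b (vt T j) <;> cases a (vt T i) <;> cases a (vt T j) <;> simp
  have hdQ' : ∀ T ∉ Q, ∀ i j, (d (vt T i) ^^ d (vt T j)) = (a (vt T i) ^^ a (vt T j)) := by
    intro T hTQ i j
    have := hbQ' T hTQ i j
    simp only [hd]
    rw [this]
    cases b (vt T j) <;> cases a (vt T i) <;> cases a (vt T j) <;> simp
  have hbcr : ∀ T, crossed b T ↔ T ∈ Q := by
    intro T
    by_cases hTQ : T ∈ Q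
    · rw [cr_of a b T (hbQ T hTQ)]
      exact ⟨fun _ => hTQ, fun h => hQF h⟩
    · refine ⟨fun ⟨i, j, h⟩ => absurd (hbQ' T hTQ i j) h, fun h => absurd h hTQ⟩
  have hdcr : ∀ T, crossed d T ↔ crossed a T ∧ T ∉ Q := by
    intro T
    by_cases hTQ : T ∈ Q
    · refine ⟨fun ⟨i, j, h⟩ => absurd (hdQ T hTQ i j) h, fun h => absurd hTQ h.2⟩
    · rw [cr_of a d T (hdQ' T hTQ)]
      exact ⟨fun h => ⟨h, hTQ⟩, fun h => h.1⟩
  have hZb : ∀ T ∈ Q, ZT s δ (wt m b) T = ZT s δ (wt m a) T := fun T h => ZT_inv s δ m (hbQ T h)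
  have hZd : ∀ T, T ∉ Q → ZT s δ (wt m d) T = ZT s δ (wt m a) T := fun T h => ZT_inv s δ m (hdQ' T h)
  -- the `d` part
  have hIH := ih {T | crossed d T}.ncard (by
    rw [← hn]
    refine ncard_lt_ncard ?_ hF
    refine ⟨fun T hT => ((hdcr T).1 hT).1, fun hsub => ?_⟩
    exact ((hdcr T0).1 (hsub hT0)).2 hQ0) d hdfin rfl (by
      intro T hTd
      obtain ⟨h1, h2⟩ := (hdcr T).1 hTd
      rw [hZd T h2]
      exact hT T h1)
  -- the `b` part
  have hfr : frontier (UU s δ t (wt m b)) = ⋃ T ∈ Q, ZT s δ (wt m a) T := by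
    rw [frontier_UU s hδ hmp hm hbfin]
    have : {T | crossed b T} = Q := by ext T; exact hbcr T
    rw [this]
    exact iUnion₂_congr hZb
  have hfrK : frontier (UU s δ t (wt m b)) ⊆ K := by
    rw [hfr]
    exact iUnion₂_subset fun T h => (hT T (hQF h)).1
  have hop : IsOpen (UU s δ t (wt m b)) :=
    isOpen_lt continuous_const (pl_cont s δ (-t) (wt_fin hm hbfin))
  have hUK := sub_of_frontier hop (UU_bdd s hδ hmp hbfin) hKc hK hKn hfrK
  have hcl : closure (UU s δ t (wt m b)) ⊆ C := (closure_minimal hUK hK.isClosed).trans hKC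
  have hhaus : hausD 1 (hDist C) (frontier (UU s δ t (wt m b))) ≤ ∑ T ∈ hQfin.toFinset, L T := by
    rw [hfr]
    have := hausD_biUnion (d := hDist C) hQfin.toFinset (fun T => ZT s δ (wt m a) T)
    simp only [Finite.mem_toFinset] at this
    refine this.trans (Finset.sum_le_sum fun T h => ?_)
    exact (hT T (hQF (by simpa using h))).2
  have hb := adm hC hop hcl (by rw [hfr]; exact hQL)
    (hhaus.trans_lt (ENNReal.sum_lt_top.2 fun T _ => hL T))
  have hb' : ENNReal.ofReal (cheeger2 C) * hMeasure C (UU s δ t (wt m b)) ≤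
      ∑' T, if T ∈ Q then L T else 0 := by
    refine (hb.trans hhaus).trans ?_
    refine le_trans (le_of_eq ?_) (ENNReal.sum_le_tsum hQfin.toFinset)
    refine Finset.sum_congr rfl fun T h => ?_
    rw [if_pos (by simpa using h)]
  have hcov : UU s δ t (wt m a) ⊆ UU s δ t (wt m b) ∪ UU s δ t (wt m d) := by
    intro x hx
    obtain ⟨T, l, h⟩ := exists_tri s hδ x
    have hx : 0 < pl s δ (-t) (wt m a) x := hx
    show 0 < pl s δ (-t) (wt m b) x ∨ 0 < pl s δ (-t) (wt m d) x
    rw [pl_tri hδ _ h] at hx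
    rw [pl_tri hδ _ h, pl_tri hδ _ h]
    have hle : ∀ c : ℤ × ℤ → Bool, (∀ i, a (vt T i) = true → c (vt T i) = true) →
        0 < l 0 * wt m c (vt T 0) + l 1 * wt m c (vt T 1) + l 2 * wt m c (vt T 2) := by
      intro c hc
      exact pos_mono hmp h hc hx
    by_cases hTQ : T ∈ Q
    · have hc := hdQ T hTQ
      cases hd0 : d (vt T 0)
      · left
        apply hle
        intro i hi
        have := hc i 0
        rw [hd0] at this
        simp only [hd, hi] at this
        simpa using this
      · right
        apply hle
        intro i _
        rw [hc i 0, hd0]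
    · have hc := hbQ' T hTQ
      cases hb0 : b (vt T 0)
      · right
        apply hle
        intro i hi
        have := hc i 0
        rw [hb0] at this
        simp [hd, hi, this]
      · left
        apply hle
        intro i _
        rw [hc i 0, hb0]
  calc ENNReal.ofReal (cheeger2 C) * hMeasure C (UU s δ t (wt m a))
      ≤ ENNReal.ofReal (cheeger2 C) * (hMeasure C (UU s δ t (wt m b)) + hMeasure C (UU s δ t (wt m d))) := by
        gcongr
        exact (measure_mono hcov).trans (measure_union_le _ _)
    _ ≤ (∑' T, if T ∈ Q then L T else 0) + ∑' T, if crossed d T then L T else 0 := by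
        rw [mul_add]
        exact add_le_add hb' hIH
    _ = ∑' T, if crossed a T then L T else 0 := by
        rw [← ENNReal.tsum_add]
        congr 1
        ext1 T
        by_cases h1 : T ∈ Q
        · have : crossed a T := hQF h1
          simp [h1, hdcr, this]
        · simp [h1, hdcr]

end HC

open MeasureTheory Set Filter
open scoped ENNReal NNReal

namespace HC

noncomputable def g0 (σ : Bool) (δ : ℝ) (g : Euc 2 → ℝ) (x : Euc 2) : ℝ :=
  match σ with
  | false => (g (x + δ • e0) - g x) / δ
  | true => (g (x + δ • e1 + δ • e0) - g (x + δ • e1)) / δ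

noncomputable def g1 (σ : Bool) (δ : ℝ) (g : Euc 2 → ℝ) (x : Euc 2) : ℝ :=
  match σ with
  | false => (g (x + δ • e0 + δ • e1) - g (x + δ • e0)) / δ
  | true => (g (x + δ • e1) - g x) / δ

noncomputable def RR (σ : Bool) (δ : ℝ) (g : Euc 2 → ℝ) (x : Euc 2) : Euc 2 :=
  rot (g0 σ δ g x) (g1 σ δ g x)

lemma PP_s0 (s : Euc 2) (δ : ℝ) (i j : ℤ) : PP s δ (i + 1, j) = PP s δ (i, j) + δ • e0 := by
  simp only [PP]; push_cast; module
lemma PP_s1 (s : Euc 2) (δ : ℝ) (i j : ℤ) : PP s δ (i, j + 1) = PP s δ (i, j) + δ • e1 := by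
  simp only [PP]; push_cast; module

/-- affine formula on a triangle -/
lemma tri_affine {s : Euc 2} {δ : ℝ} (hδ : 0 < δ) (g : Euc 2 → ℝ) {T : Tri} {x : Euc 2}
    {l : Fin 3 → ℝ} (h : InT s δ T x l) :
    l 0 * g (PP s δ (vt T 0)) + l 1 * g (PP s δ (vt T 1)) + l 2 * g (PP s δ (vt T 2)) =
    g (PP s δ T.1) + g0 T.2 δ g (PP s δ T.1) * (x 0 - PP s δ T.1 0) +
      g1 T.2 δ g (PP s δ T.1) * (x 1 - PP s δ T.1 1) := by
  obtain ⟨⟨i, j⟩, σ⟩ := T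
  have hs := h.sum
  have hl0 : l 0 = 1 - l 1 - l 2 := by linarith
  have x0 : x 0 = _ := congrArg (fun v : Euc 2 => v 0) h.eq
  have x1 : x 1 = _ := congrArg (fun v : Euc 2 => v 1) h.eq
  simp only [PiLp.add_apply, PiLp.smul_apply, smul_eq_mul, PP0, PP1] at x0 x1
  cases σ
  · have y0 : x 0 - PP s δ (i, j) 0 = δ * (l 1 + l 2) := by
      rw [x0, PP0]; simp [vt, hl0]; ring
    have y1 : x 1 - PP s δ (i, j) 1 = δ * l 2 := by
      rw [x1, PP1]; simp [vt, hl0]; ring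
    dsimp only
    rw [y0, y1]
    simp only [vt, Matrix.cons_val_zero, Matrix.cons_val_one, Matrix.cons_val, g0, g1, PP_s0, PP_s1]
    have hz : δ ≠ 0 := hδ.ne'
    rw [hl0]
    field_simp
    ring
  · have y0 : x 0 - PP s δ (i, j) 0 = δ * l 2 := by
      rw [x0, PP0]; simp [vt, hl0]; ring
    have y1 : x 1 - PP s δ (i, j) 1 = δ * (l 1 + l 2) := by
      rw [x1, PP1]; simp [vt, hl0]; ring
    dsimp only
    rw [y0, y1]
    simp only [vt, Matrix.cons_val_zero, Matrix.cons_val_one, Matrix.cons_val, g0, g1, PP_s0, PP_s1]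
    have hz : δ ≠ 0 := hδ.ne'
    rw [hl0, add_right_comm (PP s δ (i, j)) (δ • e0) (δ • e1)]
    field_simp
    ring

noncomputable def nn2 (σ : Bool) (δ : ℝ) (g : Euc 2 → ℝ) (x : Euc 2) : ℝ :=
  ‖RR σ δ g x‖

lemma norm_sq2 (v : Euc 2) : ‖v‖ ^ 2 = v 0 ^ 2 + v 1 ^ 2 := by
  rw [EuclideanSpace.norm_sq_eq]; simp

lemma RR_sq (σ : Bool) (δ : ℝ) (g : Euc 2 → ℝ) (x : Euc 2) :
    ‖RR σ δ g x‖ ^ 2 = g0 σ δ g x ^ 2 + g1 σ δ g x ^ 2 := by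
  rw [norm_sq2]; simp [RR, rot]; ring

/-- orthogonal vectors are multiples of the rotated gradient -/
lemma fNorm_orth {C : Set (Euc 2)} (hC : Good C) {x : Euc 2} (hx : x ∈ C) {a b : ℝ} {v : Euc 2}
    (hv : a * v 0 + b * v 1 = 0) (hn : rot a b ≠ 0) :
    fNorm C x v = ‖v‖ / ‖rot a b‖ * fNorm C x (rot a b) := by
  have hn' : 0 < ‖rot a b‖ := norm_pos_iff.2 hn
  have hsq : ‖rot a b‖ ^ 2 = a ^ 2 + b ^ 2 := by
    rw [norm_sq2]; simp [rot]; ring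
  have hpos : 0 < a ^ 2 + b ^ 2 := by rw [← hsq]; positivity
  set c := (a * v 1 - b * v 0) / (a ^ 2 + b ^ 2) with hc
  have hvc : v = c • rot a b := by
    ext i
    fin_cases i
    · show v 0 = (c • rot a b) 0
      simp only [PiLp.smul_apply, rot, smul_eq_mul]
      simp
      rw [hc]; field_simp; linear_combination a * hv
    · show v 1 = (c • rot a b) 1
      simp only [PiLp.smul_apply, rot, smul_eq_mul]
      simp
      rw [hc]; field_simp; linear_combination b * hv
  have hnv : ‖v‖ = |c| * ‖rot a b‖ := by
    conv_lhs => rw [hvc]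
    rw [norm_smul, Real.norm_eq_abs]
  rw [hnv, mul_div_assoc, div_self hn'.ne', mul_one]
  conv_lhs => rw [hvc]
  rw [fNorm_smul hC hx]

lemma lattice_fin (s : Euc 2) {δ : ℝ} (hδ : 0 < δ) {S : Set (Euc 2)} (hS : Bornology.IsBounded S) :
    {k | PP s δ k ∈ S}.Finite := by
  obtain ⟨B, hB⟩ := hS.subset_closedBall s
  set N : ℤ := ⌈B / δ⌉
  refine ((finite_Icc (-N) N).prod (finite_Icc (-N) N)).subset ?_
  intro k hk
  have h1 : dist (PP s δ k) s ≤ B := hB hk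
  rw [dist_eq_norm] at h1
  have c0 : |δ * k.1| ≤ B := by
    have := (PiLp.norm_apply_le (PP s δ k - s) 0).trans h1
    rw [PiLp.sub_apply, PP0] at this
    simpa using this
  have c1 : |δ * k.2| ≤ B := by
    have := (PiLp.norm_apply_le (PP s δ k - s) 1).trans h1
    rw [PiLp.sub_apply, PP1] at this
    simpa using this
  have key : ∀ z : ℤ, |δ * z| ≤ B → z ∈ Icc (-N) N := by
    intro z hz
    rw [abs_mul, abs_of_pos hδ] at hz
    have : |(z:ℝ)| ≤ B / δ := by rw [le_div_iff₀ hδ]; linarith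
    have h2 := abs_le.1 (this.trans (Int.le_ceil _))
    constructor
    · have := h2.1; exact_mod_cast this
    · have := h2.2; exact_mod_cast this
  exact ⟨key _ c0, key _ c1⟩

noncomputable def LL (C : Set (Euc 2)) (s : Euc 2) (δ : ℝ) (g : Euc 2 → ℝ) (T : Tri) : ℝ≥0∞ :=
  ENNReal.ofReal (16 * δ * (FF C (PP s δ T.1) (RR T.2 δ g (PP s δ T.1)) / ‖RR T.2 δ g (PP s δ T.1)‖))

def II (s : Euc 2) (δ : ℝ) (g : Euc 2 → ℝ) (T : Tri) : Set ℝ :=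
  Icc (g (PP s δ T.1) - 2 * δ * ‖RR T.2 δ g (PP s δ T.1)‖)
    (g (PP s δ T.1) + 2 * δ * ‖RR T.2 δ g (PP s δ T.1)‖)

lemma InT_vert (s : Euc 2) (δ : ℝ) (T : Tri) (i : Fin 3) :
    InT s δ T (PP s δ (vt T i)) (fun k => if k = i then 1 else 0) := by
  refine ⟨fun k => by split_ifs <;> norm_num, ?_, ?_⟩
  · fin_cases i <;> simp
  · fin_cases i <;> simp

lemma vert_val {s : Euc 2} {δ : ℝ} (hδ : 0 < δ) (g : Euc 2 → ℝ) (T : Tri) (i : Fin 3) :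
    |g (PP s δ (vt T i)) - g (PP s δ T.1)| ≤ 2 * δ * ‖RR T.2 δ g (PP s δ T.1)‖ := by
  have h := tri_affine hδ g (InT_vert s δ T i)
  have hl : g (PP s δ (vt T i)) - g (PP s δ T.1) =
      g0 T.2 δ g (PP s δ T.1) * (PP s δ (vt T i) 0 - PP s δ T.1 0) +
      g1 T.2 δ g (PP s δ T.1) * (PP s δ (vt T i) 1 - PP s δ T.1 1) := by
    fin_cases i <;> simp at h ⊢ <;> linarith
  rw [hl]
  have hd := PP_dist s hδ T i
  rw [dist_eq_norm] at hd
  set v := PP s δ (vt T i) - PP s δ T.1 with hv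
  have v0 : PP s δ (vt T i) 0 - PP s δ T.1 0 = v 0 := by rw [hv, PiLp.sub_apply]
  have v1 : PP s δ (vt T i) 1 - PP s δ T.1 1 = v 1 := by rw [hv, PiLp.sub_apply]
  rw [v0, v1]
  have e1 := RR_sq T.2 δ g (PP s δ T.1)
  have e2 := norm_sq2 v
  set A := g0 T.2 δ g (PP s δ T.1)
  set B := g1 T.2 δ g (PP s δ T.1)
  set R := ‖RR T.2 δ g (PP s δ T.1)‖
  have hR : 0 ≤ R := norm_nonneg _
  have : |A * v 0 + B * v 1| ≤ ‖v‖ * R := by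
    apply abs_le_of_sq_le_sq _ (by positivity)
    rw [mul_pow, e1, e2]
    nlinarith [sq_nonneg (A * v 1 - B * v 0)]
  exact this.trans (mul_le_mul_of_nonneg_right hd hR)

open Classical in
lemma level_ineq {C : Set (Euc 2)} (hC : Good C) {K : Set (Euc 2)} (hKc : Convex ℝ K)
    (hK : IsCompact K) (hKn : K.Nonempty) (hKC : K ⊆ C) {ρ r : ℝ} (hr : 0 < r)
    (hKr : ∀ x ∈ K, Metric.ball x r ⊆ C) {g : Euc 2 → ℝ} {Kg : ℝ≥0} (hg : LipschitzWith Kg g)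
    (hgK : ∀ x y, g x ≠ 0 → dist y x ≤ ρ → y ∈ K) (s : Euc 2) {δ t : ℝ} (hδ : 0 < δ)
    (hδρ : 4 * δ ≤ ρ) (hδr : 2 * δ ≤ r / 8) (ht : 0 < t) (htv : ∀ k, g (PP s δ k) ≠ t) :
    ENNReal.ofReal (cheeger2 C) * hMeasure C {x | t + 4 * δ * Kg < g x} ≤
      ∑' T, (II s δ g T).indicator (fun _ => LL C s δ g T) t := by
  set m : ℤ × ℤ → ℝ := fun v => |g (PP s δ v) - t|
  set a : ℤ × ℤ → Bool := fun v => decide (t < g (PP s δ v)) with ha_def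
  have hmp : ∀ v, 0 < m v := fun v => abs_pos.2 (sub_ne_zero.2 (htv v))
  have hw : ∀ v, wt m a v = g (PP s δ v) - t := by
    intro v
    simp only [wt, a, m, decide_eq_true_eq]
    split_ifs with h
    · exact abs_of_pos (by linarith)
    · rw [abs_of_nonpos (by linarith)]; ring
  have hsupp : {v | g (PP s δ v) ≠ 0}.Finite := by
    refine (lattice_fin s hδ hK.isBounded).subset fun v hv => ?_
    exact hgK _ _ hv (by rw [dist_self]; linarith)
  have hm : {v | m v ≠ t}.Finite := by
    refine hsupp.subset fun v hv h0 => hv ?_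
    simp only [m, h0]
    rw [zero_sub, abs_neg, abs_of_pos ht]
  have ha : {v | a v = true}.Finite := by
    refine hsupp.subset fun v hv h0 => ?_
    simp only [a, mem_ofPred_eq, decide_eq_true_eq, h0] at hv
    linarith
  -- every point of a crossed triangle lies in K
  have hin : ∀ T, crossed a T → ∀ x l, InT s δ T x l → x ∈ K := by
    intro T hT x l hx
    obtain ⟨i, hi⟩ : ∃ i, a (vt T i) = true := by
      obtain ⟨i, j, hij⟩ := hT
      cases hi : a (vt T i)
      · refine ⟨j, ?_⟩
        rw [hi] at hij
        simpa using hij.symm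
      · exact ⟨i, hi⟩
    simp only [a, decide_eq_true_eq] at hi
    refine hgK (PP s δ (vt T i)) x (by linarith) ?_
    have d1 := InT_dist hδ hx
    have d2 := PP_dist s hδ T i
    have := dist_triangle_right x (PP s δ (vt T i)) (PP s δ T.1)
    linarith
  have hmain := decomp_level hC hKc hK hKn hKC s hδ hmp hm (LL C s δ g)
    (fun T => ENNReal.ofReal_lt_top) _ a ha rfl (by
      intro T hT
      refine ⟨fun x hx => ?_, ?_⟩
      · obtain ⟨l, hl, -⟩ := mem_ZT.1 hx
        exact hin T hT x l hl
      · obtain ⟨p, q, hpq⟩ := ZT_seg s δ hmp hT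
        have hp : p ∈ ZT s δ (wt m a) T := by rw [hpq]; exact left_mem_segment ℝ p q
        have hq : q ∈ ZT s δ (wt m a) T := by rw [hpq]; exact right_mem_segment ℝ p q
        rw [hpq]
        obtain ⟨lp, hlp, hp0⟩ := mem_ZT.1 hp
        obtain ⟨lq, hlq, hq0⟩ := mem_ZT.1 hq
        have hxK : PP s δ T.1 ∈ K := by
          have : PP s δ T.1 = PP s δ (vt T 0) := by
            obtain ⟨⟨i, j⟩, _ | _⟩ := T <;> simp [vt]
          rw [this]
          exact hin T hT _ _ (InT_vert s δ T 0)
        have hb := hKr _ hxK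
        have dp := InT_dist hδ hlp
        have dq := InT_dist hδ hlq
        refine (hausD_segment hC hr hb (dp.trans hδr) (dq.trans hδr)).trans ?_
        unfold LL
        apply ENNReal.ofReal_le_ofReal
        have hxC : PP s δ T.1 ∈ C := hKC hxK
        have hFF : FF C (PP s δ T.1) (RR T.2 δ g (PP s δ T.1)) =
          fNorm C (PP s δ T.1) (RR T.2 δ g (PP s δ T.1)) := if_pos hxC
        rw [hFF]
        have hRR : RR T.2 δ g (PP s δ T.1) ≠ 0 := by
          intro h0
          have hv := fun i => vert_val hδ g T i (s := s)
          rw [h0] at hv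
          simp only [norm_zero, mul_zero, abs_nonpos_iff, sub_eq_zero] at hv
          obtain ⟨i, j, hij⟩ := hT
          apply hij
          simp only [a, hv]
        have orth : g0 T.2 δ g (PP s δ T.1) * (q - p) 0 + g1 T.2 δ g (PP s δ T.1) * (q - p) 1 = 0 := by
          have ap := tri_affine hδ g hlp
          have aq := tri_affine hδ g hlq
          simp only [hw] at hp0 hq0
          have sp := hlp.sum
          have sq := hlq.sum
          rw [PiLp.sub_apply, PiLp.sub_apply]
          linear_combination ap - aq - hp0 + hq0 - t * sp + t * sq
        rw [fNorm_orth hC hxC orth hRR]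
        have hfn := fNorm_nonneg hC hxC (RR T.2 δ g (PP s δ T.1))
        have hnp : 0 < ‖RR T.2 δ g (PP s δ T.1)‖ := norm_pos_iff.2 hRR
        have hqp : ‖q - p‖ ≤ 4 * δ := by
          rw [← dist_eq_norm]
          have := dist_triangle_right q p (PP s δ T.1)
          linarith
        change 4 * (‖q - p‖ / ‖RR T.2 δ g (PP s δ T.1)‖ * fNorm C (PP s δ T.1) (RR T.2 δ g (PP s δ T.1))) ≤ _
        calc 4 * (‖q - p‖ / ‖RR T.2 δ g (PP s δ T.1)‖ * fNorm C (PP s δ T.1) (RR T.2 δ g (PP s δ T.1)))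
            = 4 * ‖q - p‖ * (fNorm C (PP s δ T.1) (RR T.2 δ g (PP s δ T.1)) / ‖RR T.2 δ g (PP s δ T.1)‖) := by
              ring
          _ ≤ _ := by
              apply mul_le_mul_of_nonneg_right _ (by positivity)
              linarith)
  refine le_trans ?_ (hmain.trans ?_)
  · gcongr
    intro x hx
    have hx : t + 4 * δ * Kg < g x := hx
    show 0 < pl s δ (-t) (wt m a) x
    obtain ⟨T, l, h⟩ := exists_tri s hδ x
    rw [pl_tri hδ _ h]
    have hpos : ∀ i, 0 < wt m a (vt T i) := by
      intro i
      rw [hw]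
      have d1 := InT_dist hδ h
      have d2 := PP_dist s hδ T i
      have d3 := dist_triangle_right x (PP s δ (vt T i)) (PP s δ T.1)
      have d4 := hg.dist_le_mul x (PP s δ (vt T i))
      rw [Real.dist_eq] at d4
      have d5 := (le_abs_self _).trans d4
      have d6 : (Kg:ℝ) * dist x (PP s δ (vt T i)) ≤ Kg * (4 * δ) :=
        mul_le_mul_of_nonneg_left (by linarith) Kg.2
      linarith
    have hs := h.sum
    have n0 := mul_nonneg (h.nn 0) (hpos 0).le
    have n1 := mul_nonneg (h.nn 1) (hpos 1).le
    have n2 := mul_nonneg (h.nn 2) (hpos 2).le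
    by_contra hneg
    have z0 : l 0 = 0 := (mul_eq_zero.1 (by linarith : l 0 * wt m a (vt T 0) = 0)).resolve_right (hpos 0).ne'
    have z1 : l 1 = 0 := (mul_eq_zero.1 (by linarith : l 1 * wt m a (vt T 1) = 0)).resolve_right (hpos 1).ne'
    have z2 : l 2 = 0 := (mul_eq_zero.1 (by linarith : l 2 * wt m a (vt T 2) = 0)).resolve_right (hpos 2).ne'
    rw [z0, z1, z2] at hs
    norm_num at hs
  · refine ENNReal.tsum_le_tsum fun T => ?_
    split_ifs with hT
    · rw [indicator_of_mem]
      have hv := fun i => abs_le.1 (vert_val hδ g T i (s := s))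
      obtain ⟨i, j, hij⟩ := hT
      have hvi := hv i
      have hvj := hv j
      simp only [a, ne_eq, decide_eq_decide] at hij
      constructor
      · by_contra hc
        apply hij
        constructor <;> intro _ <;> linarith
      · by_contra hc
        apply hij
        constructor <;> intro _ <;> linarith
    · exact zero_le

theorem lattice_ineq {C : Set (Euc 2)} (hC : Good C) {K : Set (Euc 2)} (hKc : Convex ℝ K)
    (hK : IsCompact K) (hKn : K.Nonempty) (hKC : K ⊆ C) {ρ r : ℝ} (hr : 0 < r)
    (hKr : ∀ x ∈ K, Metric.ball x r ⊆ C) {g : Euc 2 → ℝ} {Kg : ℝ≥0} (hg : LipschitzWith Kg g)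
    (hgK : ∀ x y, g x ≠ 0 → dist y x ≤ ρ → y ∈ K) (s : Euc 2) {δ : ℝ} (hδ : 0 < δ)
    (hδρ : 4 * δ ≤ ρ) (hδr : 2 * δ ≤ r / 8) :
    ENNReal.ofReal (cheeger2 C) * ∫⁻ x, ENNReal.ofReal (g x - 4 * δ * Kg) ∂hMeasure C ≤
      ∑' T : Tri, ENNReal.ofReal (64 * δ ^ 2 * FF C (PP s δ T.1) (RR T.2 δ g (PP s δ T.1))) := by
  have hgm : Measurable g := hg.continuous.measurable
  have e1 : ∫⁻ x, ENNReal.ofReal (g x - 4 * δ * Kg) ∂hMeasure C =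
      ∫⁻ t in Ioi (0:ℝ), hMeasure C {x | t + 4 * δ * Kg < g x} := by
    have := lintegral_eq_lintegral_meas_lt (hMeasure C) (f := fun x => max (g x - 4 * δ * Kg) 0)
      (Eventually.of_forall fun x => le_max_right _ _) (by fun_prop)
    simp only [ENNReal.ofReal_max, ENNReal.ofReal_zero] at this
    rw [show (fun x => ENNReal.ofReal (g x - 4 * δ * Kg)) = fun x => max (ENNReal.ofReal (g x - 4 * δ * Kg)) 0
      by ext x; simp, this]
    refine setLIntegral_congr_fun measurableSet_Ioi fun t ht => ?_
    have ht : 0 < t := ht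
    congr 1
    ext x
    simp only [mem_ofPred_eq, lt_max_iff]
    constructor
    · rintro (h | h) <;> linarith
    · intro h; left; linarith
  rw [e1, ← lintegral_const_mul' _ _ ENNReal.ofReal_ne_top]
  have hae : ∀ᵐ t : ℝ, ∀ k, g (PP s δ k) ≠ t := by
    have hc : (range fun k => g (PP s δ k)).Countable := countable_range _
    have := hc.ae_notMem (volume : Measure ℝ)
    filter_upwards [this] with t ht k hk
    exact ht ⟨k, hk⟩
  have e2 : ∫⁻ t in Ioi (0:ℝ), ENNReal.ofReal (cheeger2 C) * hMeasure C {x | t + 4 * δ * Kg < g x} ≤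
      ∫⁻ t in Ioi (0:ℝ), ∑' T, (II s δ g T).indicator (fun _ => LL C s δ g T) t := by
    refine lintegral_mono_ae ?_
    filter_upwards [ae_restrict_of_ae hae, ae_restrict_mem measurableSet_Ioi] with t h1 h2
    exact level_ineq hC hKc hK hKn hKC hr hKr hg hgK s hδ hδρ hδr h2 h1
  refine e2.trans ((setLIntegral_le_lintegral _ _).trans ?_)
  have hIm : ∀ T, MeasurableSet (II s δ g T) := fun T => measurableSet_Icc
  rw [lintegral_tsum fun T => (measurable_const.indicator (hIm T)).aemeasurable]
  refine ENNReal.tsum_le_tsum fun T => ?_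
  rw [lintegral_indicator (hIm T), setLIntegral_const]
  unfold II LL
  rw [Real.volume_Icc]
  set R := ‖RR T.2 δ g (PP s δ T.1)‖ with hR
  set F := FF C (PP s δ T.1) (RR T.2 δ g (PP s δ T.1)) with hF
  have hR0 : 0 ≤ R := norm_nonneg _
  rw [← ENNReal.ofReal_mul' (by nlinarith)]
  apply ENNReal.ofReal_le_ofReal
  rcases eq_or_ne R 0 with h0 | h0
  · have : RR T.2 δ g (PP s δ T.1) = 0 := norm_eq_zero.1 h0
    have hF0 : F = 0 := by
      rw [hF, this]; unfold FF; split_ifs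
      · exact fNorm_zero
      · rfl
    simp [hF0]
  · apply le_of_eq
    field_simp
    ring

end HC

open MeasureTheory Set Filter
open scoped ENNReal NNReal

namespace HC

def cell (δ : ℝ) : Set (Euc 2) := {x | (0 ≤ x 0 ∧ x 0 < δ) ∧ (0 ≤ x 1 ∧ x 1 < δ)}

lemma cell_meas (δ : ℝ) : MeasurableSet (cell δ) := by
  unfold cell
  measurability

lemma cell_vol (δ : ℝ) : volume (cell δ) = ENNReal.ofReal δ * ENNReal.ofReal δ := by
  have h : cell δ = (WithLp.ofLp : Euc 2 → (Fin 2 → ℝ)) ⁻¹' (univ.pi fun _ => Ico 0 δ) := by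
    ext x
    simp [cell, Set.mem_pi, Fin.forall_fin_two]
  rw [h, (PiLp.volume_preserving_ofLp (Fin 2)).measure_preimage
    (MeasurableSet.univ_pi fun _ => measurableSet_Ico).nullMeasurableSet]
  rw [Real.volume_pi_Ico]
  simp [sq]

lemma PP_shift (s : Euc 2) (δ : ℝ) (k : ℤ × ℤ) : PP s δ k = s + PP 0 δ k := by
  simp only [PP]; module

lemma cell_sum {δ : ℝ} (hδ : 0 < δ) {Ψ : Euc 2 → ℝ≥0∞} (hΨ : Measurable Ψ) :
    ∫⁻ s in cell δ, ∑' k : ℤ × ℤ, Ψ (PP s δ k) ≤ ∫⁻ x, Ψ x := by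
  have hm : ∀ k : ℤ × ℤ, Measurable fun s : Euc 2 => Ψ (PP s δ k) := by
    intro k
    refine hΨ.comp ?_
    rw [show (fun s => PP s δ k) = fun s => s + PP 0 δ k from funext fun s => PP_shift s δ k]
    fun_prop
  rw [lintegral_tsum fun k => (hm k).aemeasurable]
  have h1 : ∀ k : ℤ × ℤ, ∫⁻ s in cell δ, Ψ (PP s δ k) =
      ∫⁻ y, (cell δ).indicator 1 (y - PP 0 δ k) * Ψ y := by
    intro k
    rw [← lintegral_indicator (cell_meas δ)]
    rw [← lintegral_sub_right_eq_self _ (PP 0 δ k)]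
    congr 1
    ext y
    by_cases hy : y - PP 0 δ k ∈ cell δ
    · simp only [indicator_of_mem hy, Pi.one_apply, one_mul]
      rw [PP_shift, sub_add_cancel]
    · simp [indicator_of_notMem hy]
  simp only [h1]
  rw [← lintegral_tsum]
  · refine lintegral_mono fun y => ?_
    rw [ENNReal.tsum_mul_right]
    refine mul_le_of_le_one_left zero_le ?_
    rw [tsum_eq_single (⌊y 0 / δ⌋, ⌊y 1 / δ⌋)]
    · exact indicator_le_self' (fun _ _ => zero_le) _
    · intro k hk
      rw [indicator_of_notMem]
      rintro ⟨⟨a1, a2⟩, b1, b2⟩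
      apply hk
      simp only [PiLp.sub_apply, PP0, PP1, PiLp.zero_apply, zero_add] at a1 a2 b1 b2
      ext
      · symm; rw [Int.floor_eq_iff, le_div_iff₀ hδ, div_lt_iff₀ hδ]
        constructor <;> linarith
      · symm; rw [Int.floor_eq_iff, le_div_iff₀ hδ, div_lt_iff₀ hδ]
        constructor <;> linarith
  · intro k
    refine Measurable.aemeasurable (Measurable.mul ?_ hΨ)
    exact (measurable_const.indicator (cell_meas δ)).comp (measurable_id.sub_const _)

noncomputable def Ps (C : Set (Euc 2)) (δ : ℝ) (g : Euc 2 → ℝ) (x : Euc 2) : ℝ≥0∞ :=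
  ENNReal.ofReal (FF C x (RR false δ g x)) + ENNReal.ofReal (FF C x (RR true δ g x))

lemma meas_rot {a b : Euc 2 → ℝ} (ha : Measurable a) (hb : Measurable b) :
    Measurable fun x => rot (a x) (b x) := by
  unfold rot
  have : Measurable fun x => ![-b x, a x] := by
    rw [measurable_pi_iff]
    intro i
    fin_cases i
    · exact hb.neg
    · exact ha
  exact (PiLp.continuous_toLp 2 _).measurable.comp this

lemma meas_RR (σ : Bool) (δ : ℝ) {g : Euc 2 → ℝ} (hg : Continuous g) : Measurable (RR σ δ g) := by
  unfold RR
  apply meas_rot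
  · cases σ <;> unfold g0 <;> fun_prop
  · cases σ <;> unfold g1 <;> fun_prop

lemma meas_FF {C : Set (Euc 2)} (hC : Good C) {v : Euc 2 → Euc 2} (hv : Measurable v) :
    Measurable fun x => FF C x (v x) :=
  (measurable_FF hC).comp (measurable_id.prodMk hv)

lemma meas_Ps {C : Set (Euc 2)} (hC : Good C) (δ : ℝ) {g : Euc 2 → ℝ} (hg : Continuous g) :
    Measurable (Ps C δ g) := by
  unfold Ps
  exact (meas_FF hC (meas_RR _ δ hg)).ennreal_ofReal.add (meas_FF hC (meas_RR _ δ hg)).ennreal_ofReal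

theorem avg_ineq {C : Set (Euc 2)} (hC : Good C) {K : Set (Euc 2)} (hKc : Convex ℝ K)
    (hK : IsCompact K) (hKn : K.Nonempty) (hKC : K ⊆ C) {ρ r : ℝ} (hr : 0 < r)
    (hKr : ∀ x ∈ K, Metric.ball x r ⊆ C) {g : Euc 2 → ℝ} {Kg : ℝ≥0} (hg : LipschitzWith Kg g)
    (hgK : ∀ x y, g x ≠ 0 → dist y x ≤ ρ → y ∈ K) {δ : ℝ} (hδ : 0 < δ)
    (hδρ : 4 * δ ≤ ρ) (hδr : 2 * δ ≤ r / 8) :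
    ENNReal.ofReal (cheeger2 C) * ∫⁻ x, ENNReal.ofReal (g x - 4 * δ * Kg) ∂hMeasure C ≤
      64 * ∫⁻ x, Ps C δ g x := by
  set A := ENNReal.ofReal (cheeger2 C) * ∫⁻ x, ENNReal.ofReal (g x - 4 * δ * Kg) ∂hMeasure C
  have hd2 : (0:ℝ) ≤ 64 * δ ^ 2 := by positivity
  have h1 : ∀ s, A ≤ ENNReal.ofReal (64 * δ ^ 2) * ∑' k, Ps C δ g (PP s δ k) := by
    intro s
    refine (lattice_ineq hC hKc hK hKn hKC hr hKr hg hgK s hδ hδρ hδr).trans ?_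
    rw [ENNReal.tsum_prod (f := fun (k : ℤ × ℤ) (σ : Bool) =>
      ENNReal.ofReal (64 * δ ^ 2 * FF C (PP s δ k) (RR σ δ g (PP s δ k)))), ← ENNReal.tsum_mul_left]
    refine le_of_eq (tsum_congr fun k => ?_)
    rw [tsum_bool]
    unfold Ps
    rw [mul_add, ← ENNReal.ofReal_mul hd2, ← ENNReal.ofReal_mul hd2]
  have h2 : ∫⁻ _ in cell δ, A ≤ ∫⁻ s in cell δ, ENNReal.ofReal (64 * δ ^ 2) * ∑' k, Ps C δ g (PP s δ k) :=
    lintegral_mono fun s => h1 s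
  rw [setLIntegral_const, lintegral_const_mul' _ _ ENNReal.ofReal_ne_top, cell_vol] at h2
  have h3 := h2.trans (mul_le_mul_right (cell_sum hδ (meas_Ps hC δ hg.continuous)) _)
  have e1 : ENNReal.ofReal δ * ENNReal.ofReal δ = ENNReal.ofReal (δ ^ 2) := by
    rw [← ENNReal.ofReal_mul hδ.le, sq]
  rw [e1, ENNReal.ofReal_mul (by norm_num), mul_comm A, mul_assoc] at h3
  have e2 : ENNReal.ofReal 64 * (ENNReal.ofReal (δ ^ 2) * ∫⁻ x, Ps C δ g x) =
      ENNReal.ofReal (δ ^ 2) * (64 * ∫⁻ x, Ps C δ g x) := by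
    rw [show ENNReal.ofReal 64 = 64 by simp]; ring
  rw [e2] at h3
  refine (ENNReal.mul_le_mul_iff_right ?_ ENNReal.ofReal_ne_top).1 h3
  have : 0 < δ ^ 2 := by positivity
  simpa using hδ.ne'

end HC

open MeasureTheory Set Filter
open scoped ENNReal NNReal

namespace HC

lemma lim_g {g : Euc 2 → ℝ} {x : Euc 2} (hg : DifferentiableAt ℝ g x) (v : Euc 2) {d : ℕ → ℝ}
    (hd : ∀ n, 0 < d n) (hd0 : Tendsto d atTop (nhds 0)) :
    Tendsto (fun n => (g (x + d n • v) - g x) / d n) atTop (nhds (fderiv ℝ g x v)) := by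
  have h := (hg.hasFDerivAt.hasLineDerivAt v)
  rw [hasLineDerivAt_iff_tendsto_slope_zero] at h
  have h2 : Tendsto d atTop (nhdsWithin 0 {0}ᶜ) :=
    tendsto_nhdsWithin_iff.2 ⟨hd0, Eventually.of_forall fun n => (hd n).ne'⟩
  refine (h.comp h2).congr fun n => ?_
  simp only [Function.comp, smul_eq_mul]
  rw [div_eq_inv_mul]

lemma lim_g0 {g : Euc 2 → ℝ} {x : Euc 2} (hg : DifferentiableAt ℝ g x) (σ : Bool) {d : ℕ → ℝ}
    (hd : ∀ n, 0 < d n) (hd0 : Tendsto d atTop (nhds 0)) :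
    Tendsto (fun n => g0 σ (d n) g x) atTop (nhds (fderiv ℝ g x e0)) := by
  cases σ
  · exact lim_g hg e0 hd hd0
  · have h := (lim_g hg (e1 + e0) hd hd0).sub (lim_g hg e1 hd hd0)
    rw [map_add, add_sub_cancel_left] at h
    refine h.congr fun n => ?_
    simp only [g0, smul_add, ← add_assoc]
    ring

lemma lim_g1 {g : Euc 2 → ℝ} {x : Euc 2} (hg : DifferentiableAt ℝ g x) (σ : Bool) {d : ℕ → ℝ}
    (hd : ∀ n, 0 < d n) (hd0 : Tendsto d atTop (nhds 0)) :
    Tendsto (fun n => g1 σ (d n) g x) atTop (nhds (fderiv ℝ g x e1)) := by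
  cases σ
  · have h := (lim_g hg (e0 + e1) hd hd0).sub (lim_g hg e0 hd hd0)
    rw [map_add, add_sub_cancel_left] at h
    refine h.congr fun n => ?_
    simp only [g1, smul_add, ← add_assoc]
    ring
  · exact lim_g hg e1 hd hd0

lemma rot_cont : Continuous fun p : ℝ × ℝ => rot p.1 p.2 := by
  unfold rot
  refine (PiLp.continuous_toLp 2 _).comp ?_
  refine continuous_pi fun i => ?_
  fin_cases i <;> simp <;> fun_prop

lemma lim_RR {g : Euc 2 → ℝ} {x : Euc 2} (hg : DifferentiableAt ℝ g x) (σ : Bool) {d : ℕ → ℝ}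
    (hd : ∀ n, 0 < d n) (hd0 : Tendsto d atTop (nhds 0)) :
    Tendsto (fun n => RR σ (d n) g x) atTop (nhds (rot (fderiv ℝ g x e0) (fderiv ℝ g x e1))) :=
  (rot_cont.tendsto (fderiv ℝ g x e0, fderiv ℝ g x e1)).comp
    ((lim_g0 hg σ hd hd0).prodMk_nhds (lim_g1 hg σ hd hd0))

lemma lim_FF {C : Set (Euc 2)} (hC : Good C) (x : Euc 2) {v : ℕ → Euc 2} {w : Euc 2}
    (h : Tendsto v atTop (nhds w)) : Tendsto (fun n => FF C x (v n)) atTop (nhds (FF C x w)) := by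
  unfold FF
  split_ifs with hx
  · exact ((fNorm_continuous hC hx).tendsto w).comp h
  · exact tendsto_const_nhds

lemma norm_e0 : ‖e0‖ = 1 := by simp [e0]
lemma norm_e1 : ‖e1‖ = 1 := by simp [e1]

lemma quot_le {g : Euc 2 → ℝ} {Kg : ℝ≥0} (hg : LipschitzWith Kg g) {δ : ℝ} (hδ : 0 < δ) (x e : Euc 2)
    (he : ‖e‖ = 1) : |(g (x + δ • e) - g x) / δ| ≤ Kg := by
  have h := hg.dist_le_mul (x + δ • e) x
  rw [Real.dist_eq, dist_eq_norm, add_sub_cancel_left, norm_smul, he, mul_one, Real.norm_eq_abs,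
    abs_of_pos hδ] at h
  rw [abs_div, abs_of_pos hδ, div_le_iff₀ hδ]
  exact h

lemma RR_le {g : Euc 2 → ℝ} {Kg : ℝ≥0} (hg : LipschitzWith Kg g) {δ : ℝ} (hδ : 0 < δ) (σ : Bool)
    (x : Euc 2) : ‖RR σ δ g x‖ ≤ 2 * Kg := by
  have a0 : |g0 σ δ g x| ≤ Kg := by
    cases σ <;> exact quot_le hg hδ _ _ norm_e0
  have a1 : |g1 σ δ g x| ≤ Kg := by
    cases σ <;> exact quot_le hg hδ _ _ norm_e1
  have hK : (0:ℝ) ≤ Kg := Kg.2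
  apply abs_le_of_sq_le_sq' _ (by positivity) |>.2
  rw [RR_sq]
  have b0 := sq_le_sq' (abs_le.1 a0).1 (abs_le.1 a0).2
  have b1 := sq_le_sq' (abs_le.1 a1).1 (abs_le.1 a1).2
  nlinarith

lemma RR_zero {g : Euc 2 → ℝ} {δ : ℝ} (hδ : 0 < δ) (σ : Bool) (x : Euc 2)
    (h : ∀ y, dist x y ≤ 2 * δ → g y = 0) : RR σ δ g x = 0 := by
  have n0 : ‖δ • e0‖ = δ := by rw [norm_smul, norm_e0, mul_one, Real.norm_eq_abs, abs_of_pos hδ]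
  have n1 : ‖δ • e1‖ = δ := by rw [norm_smul, norm_e1, mul_one, Real.norm_eq_abs, abs_of_pos hδ]
  have h0 : g x = 0 := h x (by rw [dist_self]; linarith)
  have h1 : g (x + δ • e0) = 0 := h _ (by rw [dist_self_add_right, n0]; linarith)
  have h2 : g (x + δ • e1) = 0 := h _ (by rw [dist_self_add_right, n1]; linarith)
  have h3 : g (x + δ • e0 + δ • e1) = 0 := h _ (by
    rw [add_assoc, dist_self_add_right]; refine (norm_add_le _ _).trans ?_; rw [n0, n1]; linarith)
  have h4 : g (x + δ • e1 + δ • e0) = 0 := h _ (by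
    rw [add_assoc, dist_self_add_right]; refine (norm_add_le _ _).trans ?_; rw [n0, n1]; linarith)
  have r0 : rot 0 0 = 0 := by ext i; fin_cases i <;> simp [rot]
  cases σ <;> simp [RR, g0, g1, h0, h1, h2, h3, h4, r0]

open Pointwise in
theorem coarea {C : Set (Euc 2)} (hC : Good C) {g : Euc 2 → ℝ} {Kg : ℝ≥0} (hg : LipschitzWith Kg g)
    (hcs : HasCompactSupport g) (hsub : tsupport g ⊆ C) (hne : (tsupport g).Nonempty) :
    ENNReal.ofReal (cheeger2 C) * ∫⁻ x, ENNReal.ofReal (g x) ∂hMeasure C ≤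
      128 * ∫⁻ x, ENNReal.ofReal (FF C x (rot (fderiv ℝ g x e0) (fderiv ℝ g x e1))) := by
  have hcs' : IsCompact (tsupport g) := hcs
  obtain ⟨ρ2, hρ2, hρ2C⟩ := hcs'.exists_cthickening_subset_open hC.op hsub
  obtain ⟨ρ, hρ, hρρ⟩ : ∃ ρ : ℝ, 0 < ρ ∧ ρ + ρ = ρ2 := ⟨ρ2 / 2, by linarith, by ring⟩
  set K := closure (convexHull ℝ (Metric.cthickening ρ (tsupport g))) with hKdef
  have hTc : IsCompact (Metric.cthickening ρ (tsupport g)) := hcs'.cthickening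
  have hK : IsCompact K := by
    apply Metric.isCompact_of_isClosed_isBounded isClosed_closure
    exact ((isBounded_convexHull).2 hTc.isBounded).closure
  have hKc : Convex ℝ K := (convex_convexHull ℝ _).closure
  have hsubK : Metric.cthickening ρ (tsupport g) ⊆ K :=
    (subset_convexHull ℝ _).trans subset_closure
  have hKC : K ⊆ C := by
    have h1 : Metric.cthickening ρ (tsupport g) + Metric.ball (0 : Euc 2) ρ ⊆ C := by
      rintro _ ⟨a, ha, b, hb, rfl⟩
      apply hρ2C
      rw [← hρρ]
      rw [hcs'.cthickening_eq_biUnion_closedBall hρ.le] at ha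
      simp only [mem_iUnion, Metric.mem_closedBall] at ha
      obtain ⟨z, hz, haz⟩ := ha
      refine Metric.mem_cthickening_of_dist_le _ z _ _ hz ?_
      have hb' : ‖b‖ < ρ := by simpa using hb
      have h3 : dist (a + b) a ≤ ρ := by rw [dist_self_add_left]; exact hb'.le
      exact (dist_triangle _ a _).trans (by linarith)
    have h2 := convexHull_min h1 hC.conv
    rw [convexHull_add, (convex_ball (0 : Euc 2) ρ).convexHull_eq] at h2
    refine Subset.trans ?_ h2
    intro y hy
    obtain ⟨z, hz, hyz⟩ := Metric.mem_closure_iff.1 hy ρ hρ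
    refine ⟨z, hz, y - z, ?_, by simp⟩
    rw [mem_ball_zero_iff, ← dist_eq_norm]; exact hyz
  have hKn : K.Nonempty := (hne.mono (Metric.self_subset_cthickening _)).mono hsubK
  obtain ⟨r, hr, hKr⟩ := exists_thick hC hK hKC
  have hgK : ∀ x y, g x ≠ 0 → dist y x ≤ ρ → y ∈ K := by
    intro x y hx hxy
    apply hsubK
    exact Metric.mem_cthickening_of_dist_le y x ρ _ (subset_tsupport g hx) hxy
  obtain ⟨N, hN⟩ : ∃ N : ℕ, ∀ n : ℕ, 4 * (1 / ((n:ℝ) + 1 + N)) ≤ ρ ∧ 2 * (1 / ((n:ℝ) + 1 + N)) ≤ r / 8 := by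
    obtain ⟨N, hN⟩ := exists_nat_gt (max (4 / ρ) (16 / r))
    refine ⟨N, fun n => ?_⟩
    have h1 : 4 / ρ < N := (le_max_left _ _).trans_lt hN
    have h2 : 16 / r < N := (le_max_right _ _).trans_lt hN
    have hn : (0:ℝ) ≤ n := Nat.cast_nonneg n
    have hN0 : (0:ℝ) ≤ N := Nat.cast_nonneg N
    rw [div_lt_iff₀ hρ] at h1
    rw [div_lt_iff₀ hr] at h2
    have hp : (0:ℝ) < n + 1 + N := by positivity
    constructor
    · rw [mul_one_div, div_le_iff₀ hp]; nlinarith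
    · rw [mul_one_div, div_le_iff₀ hp]; nlinarith
  set d : ℕ → ℝ := fun n => 1 / ((n:ℝ) + 1 + N) with hddef
  have hd : ∀ n, 0 < d n := fun n => by simp only [d]; positivity
  have hd0 : Tendsto d atTop (nhds 0) := by
    have : Tendsto (fun n : ℕ => (n:ℝ) + 1 + N) atTop atTop :=
      tendsto_atTop_add_const_right _ _ (tendsto_atTop_add_const_right _ _ tendsto_natCast_atTop_atTop)
    refine this.inv_tendsto_atTop.congr fun n => ?_
    simp [d]
  have hineq := fun n => avg_ineq hC hKc hK hKn hKC hr hKr hg hgK (hd n) (hN n).1 (hN n).2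
  -- left side
  have hL : ∫⁻ x, ENNReal.ofReal (g x) ∂hMeasure C ≤
      liminf (fun n => ∫⁻ x, ENNReal.ofReal (g x - 4 * d n * Kg) ∂hMeasure C) atTop := by
    have := lintegral_liminf_le (u := atTop) (μ := hMeasure C) (f := fun n x => ENNReal.ofReal (g x - 4 * d n * Kg))
      (fun n => by have := hg.continuous.measurable; fun_prop)
    refine le_trans (le_of_eq ?_) this
    congr 1
    ext x
    symm
    apply Tendsto.liminf_eq
    apply ENNReal.tendsto_ofReal
    have : Tendsto (fun n => g x - 4 * d n * Kg) atTop (nhds (g x - 4 * 0 * Kg)) :=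
      tendsto_const_nhds.sub ((hd0.const_mul 4).mul_const _)
    simpa using this
  -- right side
  set Lim : Euc 2 → ℝ≥0∞ := fun x =>
    ENNReal.ofReal (FF C x (rot (fderiv ℝ g x e0) (fderiv ℝ g x e1))) with hLim
  have hRlim : Tendsto (fun n => ∫⁻ x, Ps C (d n) g x) atTop (nhds (∫⁻ x, (Lim x + Lim x))) := by
    have hFb : ∀ n σ x, ENNReal.ofReal (FF C x (RR σ (d n) g x)) ≤
        K.indicator (fun _ => ENNReal.ofReal (2 * Kg / r)) x := by
      intro n σ x
      by_cases hx : x ∈ K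
      · rw [indicator_of_mem hx]
        apply ENNReal.ofReal_le_ofReal
        unfold FF
        rw [if_pos (hKC hx)]
        refine (fNorm_le hC hr (hKr x hx) _).trans ?_
        gcongr
        exact RR_le hg (hd n) σ x
      · rw [RR_zero (hd n) σ x]
        · unfold FF; simp [fNorm_zero]
        · intro y hy
          by_contra h0
          exact hx (hgK y x h0 (hy.trans (by linarith [(hN n).1, hd n])))
    refine tendsto_lintegral_of_dominated_convergence
      (fun x => K.indicator (fun _ => ENNReal.ofReal (2 * Kg / r)) x +
        K.indicator (fun _ => ENNReal.ofReal (2 * Kg / r)) x) (fun n => meas_Ps hC (d n) hg.continuous)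
      (fun n => Eventually.of_forall fun x => add_le_add (hFb n _ x) (hFb n _ x)) ?_ ?_
    · rw [lintegral_add_left (measurable_const.indicator hK.measurableSet),
        lintegral_indicator hK.measurableSet, setLIntegral_const]
      have := hK.measure_lt_top (μ := (volume : Measure (Euc 2)))
      have h2 := ENNReal.mul_ne_top (ENNReal.ofReal_ne_top (r := 2 * Kg / r)) this.ne
      exact ENNReal.add_ne_top.2 ⟨h2, h2⟩
    · filter_upwards [hg.ae_differentiableAt (μ := (volume : Measure (Euc 2)))] with x hx
      exact (ENNReal.tendsto_ofReal (lim_FF hC x (lim_RR hx false hd hd0))).add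
        (ENNReal.tendsto_ofReal (lim_FF hC x (lim_RR hx true hd hd0)))
  have hLm : Measurable Lim := by
    refine (meas_FF hC (meas_rot ?_ ?_)).ennreal_ofReal
    · exact measurable_fderiv_apply_const ℝ g e0
    · exact measurable_fderiv_apply_const ℝ g e1
  have hfin : (ENNReal.ofReal (cheeger2 C)) * liminf (fun n => ∫⁻ x, ENNReal.ofReal (g x - 4 * d n * Kg) ∂hMeasure C) atTop
      ≤ 64 * ∫⁻ x, (Lim x + Lim x) := by
    have h1 := ENNReal.Tendsto.const_mul (a := 64) hRlim (Or.inr (by norm_num))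
    rw [← h1.liminf_eq]
    rw [← ENNReal.liminf_const_mul_of_ne_top ENNReal.ofReal_ne_top]
    exact liminf_le_liminf (Eventually.of_forall hineq)
  refine (mul_le_mul_right hL _).trans (hfin.trans (le_of_eq ?_))
  rw [lintegral_add_left hLm, ← two_mul, ← mul_assoc]
  norm_num

end HC

open MeasureTheory Set Filter
open scoped ENNReal NNReal
namespace HC

lemma hMeasure_restrict {C : Set (Euc 2)} (hC : Good C) : (hMeasure C).restrict C = hMeasure C := by
  unfold hMeasure
  rw [restrict_withDensity hC.op.measurableSet, Measure.restrict_restrict hC.op.measurableSet,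
    inter_self]

lemma dual_smul_le {C : Set (Euc 2)} (hC : Good C) {x : Euc 2} (hx : x ∈ C) (c : ℝ)
    (l : Euc 2 →L[ℝ] ℝ) : dualNorm C x (c • l) ≤ |c| * dualNorm C x l := by
  apply csSup_le (dual_ne hC hx _)
  rintro _ ⟨u, hu, rfl⟩
  have hu' : fNorm C x u = 1 := hu
  have h := le_dual hC hx l (c • u)
  rw [fNorm_smul hC hx, hu', map_smul, mul_one, mul_comm] at h
  simpa [smul_eq_mul, mul_comm] using h

lemma integrable_of_bdd {C : Set (Euc 2)} (hC : Good C) {K : Set (Euc 2)} (hK : IsCompact K)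
    (hKC : K ⊆ C) {φ : Euc 2 → ℝ} (hm : Measurable φ) {B : ℝ} (hB : ∀ x ∈ K, |φ x| ≤ B)
    (h0 : ∀ x, x ∉ K → φ x = 0) : Integrable φ (hMeasure C) := by
  have h1 : Integrable (K.indicator fun _ => B) (hMeasure C) :=
    (integrable_indicator_iff hK.measurableSet).2
      (integrableOn_const (hMeasure_compact hC hK hKC).ne)
  refine h1.mono' hm.aestronglyMeasurable (Eventually.of_forall fun x => ?_)
  by_cases hx : x ∈ K
  · rw [indicator_of_mem hx]; exact hB x hx
  · rw [indicator_of_notMem hx, h0 x hx]; simp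

lemma cheeger_nonneg (C : Set (Euc 2)) : 0 ≤ cheeger2 C := by
  apply Real.sInf_nonneg
  rintro _ ⟨U, -, -, -, -, rfl⟩
  positivity

lemma rayleigh_ge {C : Set (Euc 2)} (hC : Good C) {f : Euc 2 → ℝ} (hf : f ∈ testFuns C) :
    (1 / (6144 / omegaVol 2) ^ 2) * cheeger2 C ^ 2 ≤ rayleigh C C f := by
  obtain ⟨⟨K, hL⟩, hf0, hcs, hsub⟩ := hf
  set A : ℝ := 6144 / omegaVol 2 with hA
  have hA0 : 0 < A := div_pos (by norm_num) omega_pos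
  set h := cheeger2 C with hh
  have hh0 : 0 ≤ h := cheeger_nonneg C
  set D : Euc 2 → ℝ := fun x => DN C x (fderiv ℝ f x) with hD
  have hT : IsCompact (tsupport f) := hcs
  have hfc : Continuous f := hL.continuous
  obtain ⟨M, hM⟩ : ∃ M, ∀ x, ‖f x‖ ≤ M := hcs.exists_bound_of_continuous hfc
  have hM0 : 0 ≤ M := (norm_nonneg _).trans (hM 0)
  have hDm : Measurable D := measurable_DN hC (measurable_fderiv ℝ f)
  have hD0 : ∀ x, 0 ≤ D x := by
    intro x; simp only [D, DN]; split_ifs with hx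
    · exact dual_nonneg hC hx _
    · exact le_rfl
  obtain ⟨R, hR, hRd⟩ := dual_le hC
  have hDb : ∀ x, D x ≤ R * K := by
    intro x; simp only [D, DN]; split_ifs with hx
    · refine (hRd x hx _).trans ?_
      gcongr
      exact norm_fderiv_le_of_lipschitz ℝ hL
    · positivity
  have hfz : ∀ x, x ∉ tsupport f → f x = 0 := fun x hx => image_eq_zero_of_notMem_tsupport hx
  have hDz : ∀ x, x ∉ tsupport f → D x = 0 := by
    intro x hx
    have h1 : fderiv ℝ f x = 0 := by
      by_contra hne
      exact hx (support_fderiv_subset ℝ hne)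
    have h2 : D x ≤ 0 := by
      simp only [D, DN]; split_ifs with hxC
      · have := hRd x hxC (fderiv ℝ f x)
        rw [h1, norm_zero, mul_zero] at this
        rw [h1]; exact this
      · exact le_rfl
    exact le_antisymm h2 (hD0 x)
  have if2 : Integrable (fun x => f x ^ 2) (hMeasure C) := by
    refine integrable_of_bdd hC hT hsub (hfc.measurable.pow_const 2) (B := M ^ 2) ?_ ?_
    · intro x _
      rw [abs_pow]; exact pow_le_pow_left₀ (abs_nonneg _) (hM x) 2
    · intro x hx; simp [hfz x hx]
  have iD2 : Integrable (fun x => D x ^ 2) (hMeasure C) := by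
    refine integrable_of_bdd hC hT hsub (hDm.pow_const 2) (B := (R * K) ^ 2) ?_ ?_
    · intro x _
      rw [abs_pow, abs_of_nonneg (hD0 x)]; exact pow_le_pow_left₀ (hD0 x) (hDb x) 2
    · intro x hx; simp [hDz x hx]
  have hfm : Measurable fun x => |f x| := hfc.abs.measurable
  have ifD : Integrable (fun x => |f x| * D x) (hMeasure C) := by
    refine integrable_of_bdd hC hT hsub (hfm.mul hDm) (B := M * (R * K)) ?_ ?_
    · intro x _
      rw [abs_mul, abs_abs, abs_of_nonneg (hD0 x)]
      exact mul_le_mul (hM x) (hDb x) (hD0 x) hM0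
    · intro x hx; simp [hDz x hx]
  -- positivity
  have hpos : 0 < ∫ x, f x ^ 2 ∂hMeasure C := by
    rw [integral_pos_iff_support_of_nonneg (fun x => sq_nonneg _) if2]
    have hs : (Function.support fun x => f x ^ 2) = Function.support f := by
      ext x; simp
    rw [hs, hMeasure_eq hC]
    rw [pos_iff_ne_zero, Ne, withDensity_apply_eq_zero (measurable_rd hC).ennreal_ofReal]
    have hs2 : {x | ENNReal.ofReal (rd C x) ≠ 0} ∩ Function.support f = Function.support f := by
      apply inter_eq_right.2
      intro x hx
      have := rd_pos hC (hsub (subset_tsupport f hx))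
      simpa using this
    rw [hs2]
    have ho : IsOpen (Function.support f) := hfc.isOpen_support
    exact (ho.measure_pos volume (Function.support_nonempty_iff.2 hf0)).ne'
  -- coarea
  have hgL : LipschitzWith (Real.toNNReal (2 * M * K)) fun x => f x ^ 2 := by
    apply LipschitzWith.of_dist_le_mul
    intro x y
    rw [Real.coe_toNNReal _ (by positivity), Real.dist_eq]
    have h1 := hL.dist_le_mul x y
    rw [Real.dist_eq] at h1
    have h2 : f x ^ 2 - f y ^ 2 = (f x + f y) * (f x - f y) := by ring
    rw [h2, abs_mul]
    have h3 : |f x + f y| ≤ 2 * M := (abs_add_le _ _).trans (by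
      have := hM x; have := hM y; simp only [Real.norm_eq_abs] at *; linarith)
    calc _ ≤ (2 * M) * (K * dist x y) := mul_le_mul h3 h1 (abs_nonneg _) (by positivity)
      _ = _ := by ring
  have hts : tsupport (fun x => f x ^ 2) = tsupport f := by
    unfold tsupport
    congr 1
    ext x; simp
  have hgcs : HasCompactSupport fun x => f x ^ 2 := by
    unfold HasCompactSupport; rw [hts]; exact hT
  have hne : (tsupport fun x => f x ^ 2).Nonempty := by
    rw [hts]; exact (Function.support_nonempty_iff.2 hf0).mono (subset_tsupport f)
  have hco := coarea hC hgL hgcs (by rw [hts]; exact hsub) hne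
  have hup : ∫⁻ x, ENNReal.ofReal (FF C x (rot (fderiv ℝ (fun x => f x ^ 2) x e0)
      (fderiv ℝ (fun x => f x ^ 2) x e1))) ≤
      ∫⁻ x, ENNReal.ofReal (48 / omegaVol 2 * (|f x| * D x)) ∂hMeasure C := by
    have hmm : Measurable fun x => ENNReal.ofReal (48 / omegaVol 2 * (|f x| * D x)) :=
      ((hfm.mul hDm).const_mul _).ennreal_ofReal
    rw [hMeasure_eq hC, lintegral_withDensity_eq_lintegral_mul _ (measurable_rd hC).ennreal_ofReal hmm]
    apply lintegral_mono_ae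
    filter_upwards [hL.ae_differentiableAt (μ := (volume : Measure (Euc 2)))] with x hx
    simp only [Pi.mul_apply]
    rw [← ENNReal.ofReal_mul (rd_nonneg x)]
    apply ENNReal.ofReal_le_ofReal
    by_cases hxC : x ∈ C
    · have hder : fderiv ℝ (fun x => f x ^ 2) x = (2 * f x) • fderiv ℝ f x := by
        rw [fderiv_fun_pow 2 hx]
        simp
      rw [hder]
      simp only [FF, rd, D, DN, if_pos hxC]
      have h1 := area_ineq hC hxC ((2 * f x) • fderiv ℝ f x)
      have h2 := dual_smul_le hC hxC (2 * f x) (fderiv ℝ f x)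
      have h3 := tb_pos hC hxC
      have h4 := omega_pos
      rw [abs_mul, abs_two] at h2
      have h5 : omegaVol 2 / (volume (tangentBall C x 1)).toReal *
        (48 / omegaVol 2 * (|f x| * dualNorm C x (fderiv ℝ f x))) =
        (48 * (|f x| * dualNorm C x (fderiv ℝ f x))) / (volume (tangentBall C x 1)).toReal := by
        field_simp
      rw [h5, le_div_iff₀ h3]
      linarith
    · simp [FF, rd, hxC]
  have hreal : h * ∫ x, f x ^ 2 ∂hMeasure C ≤ A * ∫ x, |f x| * D x ∂hMeasure C := by
    have h1 := hco.trans (mul_le_mul_right hup 128)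
    have i2 : Integrable (fun x => 48 / omegaVol 2 * (|f x| * D x)) (hMeasure C) := ifD.const_mul _
    have hc : 0 ≤ 48 / omegaVol 2 := div_nonneg (by norm_num) omega_pos.le
    have hn2 : ∀ x, 0 ≤ 48 / omegaVol 2 * (|f x| * D x) := fun x =>
      mul_nonneg hc (mul_nonneg (abs_nonneg _) (hD0 x))
    rw [← ofReal_integral_eq_lintegral_ofReal if2 (Eventually.of_forall fun x => sq_nonneg _),
      ← ofReal_integral_eq_lintegral_ofReal i2 (Eventually.of_forall hn2),
      ← ENNReal.ofReal_mul hh0, show (128 : ℝ≥0∞) = ENNReal.ofReal 128 by simp,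
      ← ENNReal.ofReal_mul (by norm_num)] at h1
    rw [ENNReal.ofReal_le_ofReal_iff (mul_nonneg (by norm_num) (integral_nonneg hn2)),
      integral_const_mul] at h1
    refine h1.trans (le_of_eq ?_)
    rw [hA]; ring
  -- conclusion
  have hray : rayleigh C C f = (∫ x, D x ^ 2 ∂hMeasure C) / ∫ x, f x ^ 2 ∂hMeasure C := by
    unfold rayleigh
    have h1 : ∫ p in C, dualNorm C p (fderiv ℝ f p) ^ 2 ∂hMeasure C =
        ∫ p in C, D p ^ 2 ∂hMeasure C := by
      apply setIntegral_congr_fun hC.op.measurableSet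
      intro p hp
      simp [D, DN, hp]
    rw [h1, hMeasure_restrict hC]
  rw [hray, le_div_iff₀ hpos]
  have hDn : 0 ≤ ∫ x, D x ^ 2 ∂hMeasure C := integral_nonneg fun x => sq_nonneg _
  rcases hh0.eq_or_lt with h0 | hhp
  · rw [← h0]; simpa using hDn
  have ham : A * ∫ x, |f x| * D x ∂hMeasure C ≤
      (h / 2) * (∫ x, f x ^ 2 ∂hMeasure C) + A ^ 2 / (2 * h) * ∫ x, D x ^ 2 ∂hMeasure C := by
    rw [← integral_const_mul, ← integral_const_mul, ← integral_const_mul,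
      ← integral_add (if2.const_mul _) (iD2.const_mul _)]
    apply integral_mono (ifD.const_mul _) ((if2.const_mul _).add (iD2.const_mul _))
    intro x
    have key : h / 2 * f x ^ 2 + A ^ 2 / (2 * h) * D x ^ 2 - A * (|f x| * D x) =
        (h * |f x| - A * D x) ^ 2 / (2 * h) := by
      rw [← sq_abs (f x)]; field_simp; ring
    have : 0 ≤ (h * |f x| - A * D x) ^ 2 / (2 * h) := by positivity
    simp only [Pi.add_apply]
    linarith
  have hf1 : (h / 2) * (∫ x, f x ^ 2 ∂hMeasure C) ≤ A ^ 2 / (2 * h) * ∫ x, D x ^ 2 ∂hMeasure C := by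
    linarith
  have hf2 := mul_le_mul_of_nonneg_left hf1 (show 0 ≤ 2 * h / A ^ 2 by positivity)
  have e1 : 2 * h / A ^ 2 * ((h / 2) * (∫ x, f x ^ 2 ∂hMeasure C)) =
      1 / A ^ 2 * h ^ 2 * ∫ x, f x ^ 2 ∂hMeasure C := by field_simp
  have e2 : 2 * h / A ^ 2 * (A ^ 2 / (2 * h) * ∫ x, D x ^ 2 ∂hMeasure C) =
      ∫ x, D x ^ 2 ∂hMeasure C := by field_simp
  rw [e1, e2] at hf2
  exact hf2

lemma testFuns_nonempty {C : Set (Euc 2)} (ho : IsOpen C) (hn : C.Nonempty) :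
    (testFuns C).Nonempty := by
  obtain ⟨x0, hx0⟩ := hn
  obtain ⟨r, hr, hb⟩ := Metric.nhds_basis_closedBall.mem_iff.1 (ho.mem_nhds hx0)
  have hs : tsupport (fun x => max (r - dist x x0) 0) ⊆ Metric.closedBall x0 r := by
    apply closure_minimal _ Metric.isClosed_closedBall
    intro x hx
    by_contra hxn
    apply hx
    simp only [Metric.mem_closedBall, not_le] at hxn
    exact max_eq_right (by linarith)
  refine ⟨fun x => max (r - dist x x0) 0, ⟨1, ?_⟩, ?_, ?_, hs.trans hb⟩
  · apply LipschitzWith.max_const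
    apply LipschitzWith.of_dist_le_mul
    intro x y
    rw [Real.dist_eq, NNReal.coe_one, one_mul]
    have h1 : r - dist x x0 - (r - dist y x0) = -(dist x x0 - dist y x0) := by ring
    rw [h1, abs_neg]
    exact abs_dist_sub_le x y x0
  · intro h
    have := congrFun h x0
    simp at this
    linarith
  · exact (isCompact_closedBall x0 r).of_isClosed_subset (isClosed_tsupport _) hs

theorem final : ∃ K : ℝ, 0 < K ∧ ∀ C : Set (Euc 2), Convex ℝ C → IsOpen C →
      Bornology.IsBounded C → C.Nonempty → lambda1 C ≥ K * cheeger2 C ^ 2 := by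
  refine ⟨1 / (6144 / omegaVol 2) ^ 2, ?_, ?_⟩
  · have := omega_pos; positivity
  · intro C h1 h2 h3 h4
    apply le_csInf ((testFuns_nonempty h2 h4).image _)
    rintro _ ⟨f, hf, rfl⟩
    exact rayleigh_ge ⟨h1, h2, h3⟩ hf

end HC

/-- there is a universal constant `K > 0` such that every bounded open
convex subset `C` of `ℝ²` satisfies `λ₁(C) ≥ K·I_∞(C)²`. -/
theorem stmt14 :
    ∃ K : ℝ, 0 < K ∧ ∀ C : Set (Euc 2), Convex ℝ C → IsOpen C →
      Bornology.IsBounded C → C.Nonempty → lambda1 C ≥ K * cheeger2 C ^ 2 := by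
  exact HC.final
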